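/- arXiv:2308.01580 — 3 statements merged into one kernel-verified Lean document; each statement's English description precedes it below -/
import Mathlib

section
/- Fix an integer n ≥ 3 and 0 < h < 1/2. If (δ,γ) solves the system at (n,h), then every v ∈ W_h satisfies ∫₀¹ r^{n−1}·v'(r)² dr ≥ (S^n + δ²)·∫₀¹ r^{n−3}·v(r)² dr; in particular μ_h^n ≥ S^n + δ². -/
open MeasureTheory Real Set Filter

noncomputable section

/-- `u ∈ H¹(0,1)` with weak derivative `u'`: `u` is continuous on `[0,1]`,
`u'` is (square-)integrable on `(0,1)`, and `u(x) = u(0) + ∫₀ˣ u'`. -/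
def IsH1 (u u' : ℝ → ℝ) : Prop :=
  ContinuousOn u (Set.Icc 0 1) ∧
  IntervalIntegrable u' volume 0 1 ∧
  IntegrableOn (fun t => u' t ^ 2) (Set.Ioo 0 1) ∧
  ∀ x ∈ Set.Icc (0:ℝ) 1, u x = u 0 + ∫ t in (0:ℝ)..x, u' t

/-- `f_m(h) = (1/m)·Σ_{k=0}^{m−1} (1−h)^{2−n+k}` (for the fixed dimension `n`). -/
def fm (n m : ℕ) (h : ℝ) : ℝ :=
  (1 / (m : ℝ)) * ∑ k ∈ Finset.range m, (1 - h) ^ ((2 : ℤ) - (n : ℤ) + (k : ℤ))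

/-- `g_n(h) = f_n(h) − 2 f_{n−1}(h) + f_{n−2}(h)`. -/
def gn (n : ℕ) (h : ℝ) : ℝ := fm n n h - 2 * fm n (n - 1) h + fm n (n - 2) h

/-- `(δ,γ)` solves the system at `(n,h)`. -/
def SolvesSystem (n : ℕ) (h δ γ : ℝ) : Prop :=
  0 < δ ∧ 4 * δ ^ 2 ≤ (n : ℝ) * ((n : ℝ) - 2) ∧
  (∀ r ∈ Set.Icc h (1 - h), γ + δ * Real.log r ∈ Set.Ioo (-(π/2)) (π/2)) ∧
  (((n : ℝ) ^ 2 - 2 * (n : ℝ)) / 2 - 2 * δ ^ 2)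
      * ((n : ℝ) ^ 2 / 4 - δ ^ 2 + (n : ℝ) * δ * Real.tan (γ + δ * Real.log h))
    = (((n : ℝ) - 2) / ((n : ℝ) - 1)) * ((n : ℝ) ^ 2 / 4 + δ ^ 2) ^ 2 ∧
  ((n : ℝ) - 2) / 2 + δ * Real.tan (γ + δ * Real.log (1 - h))
    = (1 / h) * (fm n n h - gn n h * (((n : ℝ) - 2) ^ 2 / 4 + δ ^ 2))

/-- `v ∈ W_h` (with weak derivative `v'`): `v ∈ H¹(0,1)`, `v(1) = 0`, and `v` is
affine on `[0,h]` and on `[1−h,1]`. -/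
def MemWh (h : ℝ) (v v' : ℝ → ℝ) : Prop :=
  IsH1 v v' ∧ v 1 = 0 ∧
  (∃ a b : ℝ, ∀ x ∈ Set.Icc (0:ℝ) h, v x = a * x + b) ∧
  (∃ a b : ℝ, ∀ x ∈ Set.Icc (1 - h) (1:ℝ), v x = a * x + b)

/-- `μ_h^n`: the infimum of the weighted Hardy Rayleigh quotient over nonzero `v ∈ W_h`. -/
def munh (n : ℕ) (h : ℝ) : ℝ :=
  sInf { s : ℝ | ∃ v v' : ℝ → ℝ, MemWh h v v' ∧ (∃ x ∈ Set.Icc (0:ℝ) 1, v x ≠ 0) ∧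
    s = (∫ r in (0:ℝ)..1, r ^ (n - 1) * (v' r) ^ 2)
        / (∫ r in (0:ℝ)..1, r ^ (n - 3) * (v r) ^ 2) }

lemma aux_fm (n m : ℕ) (hn : 2 ≤ n) (hm : 0 < m) (h : ℝ) (h1 : h < 1) :
    h * (1 - h) ^ (n - 2) * fm n m h = (1 - (1 - h) ^ m) / m := by
  have hne : (1 - h) ≠ 0 := by linarith
  obtain ⟨j, rfl⟩ : ∃ j, n = j + 2 := ⟨n - 2, by omega⟩
  have hs : ∑ k ∈ Finset.range m, (1 - h) ^ ((2 : ℤ) - ((j + 2 : ℕ) : ℤ) + (k : ℤ))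
      = ((1 - h) ^ j)⁻¹ * ∑ k ∈ Finset.range m, (1 - h) ^ k := by
    rw [Finset.mul_sum]
    refine Finset.sum_congr rfl fun k _ => ?_
    rw [show (2 : ℤ) - ((j + 2 : ℕ) : ℤ) + (k : ℤ) = -(j : ℤ) + (k : ℤ) by push_cast; ring,
      zpow_add₀ hne, zpow_neg, zpow_natCast, zpow_natCast]
  have hg := mul_neg_geom_sum (1 - h) m
  have hm' : (m : ℝ) ≠ 0 := by positivity
  unfold fm
  rw [hs, ← hg]
  have hj : (1 - h) ^ j ≠ 0 := pow_ne_zero _ hne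
  simp only [Nat.add_sub_cancel]
  field_simp
  ring

lemma aux_ae {v v' : ℝ → ℝ} (hv : IsH1 v v') :
    ∀ᵐ x, x ∈ Set.Ioo (0:ℝ) 1 → HasDerivAt v (v' x) x := by
  obtain ⟨-, hi, -, heq⟩ := hv
  filter_upwards [hi.ae_hasDerivAt_integral] with x hx hx01
  have hx' := hx (by rw [uIcc_of_le zero_le_one]; exact Ioo_subset_Icc_self hx01) 0 (by simp)
  refine (hx'.const_add (v 0)).congr_of_eventuallyEq ?_
  filter_upwards [Ioo_mem_nhds hx01.1 hx01.2] with y hy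
  exact heq y (Ioo_subset_Icc_self hy)

lemma aux_sqint {v v' : ℝ → ℝ} (hv : IsH1 v v') :
    IntervalIntegrable (fun t => v' t ^ 2) volume 0 1 := by
  rw [intervalIntegrable_iff_integrableOn_Ioo_of_le zero_le_one]
  exact hv.2.2.1

lemma aux_affine {v v' : ℝ → ℝ} (hv : IsH1 v v') {α β a b : ℝ} (k : ℕ) (h0 : 0 ≤ α) (hαβ : α ≤ β)
    (h1 : β ≤ 1) (haff : ∀ x ∈ Set.Icc α β, v x = a * x + b) :
    ∫ r in α..β, r ^ k * v' r ^ 2 = a ^ 2 * ∫ r in α..β, r ^ k := by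
  rw [← intervalIntegral.integral_const_mul]
  apply intervalIntegral.integral_congr_ae
  have hne : ∀ᵐ x : ℝ, x ≠ β := by simp [ae_iff, measure_singleton]
  filter_upwards [aux_ae hv, hne] with x hx hxb hxm
  rw [uIoc_of_le hαβ] at hxm
  have hxI : x ∈ Set.Ioo α β := ⟨hxm.1, lt_of_le_of_ne hxm.2 hxb⟩
  have hd := hx ⟨lt_of_le_of_lt h0 hxI.1, lt_of_lt_of_le hxI.2 h1⟩
  have hd2 : HasDerivAt v a x := by
    have : HasDerivAt (fun x : ℝ => a * x + b) a x := by
      simpa using ((hasDerivAt_id x).const_mul a).add_const b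
    refine this.congr_of_eventuallyEq ?_
    filter_upwards [Ioo_mem_nhds hxI.1 hxI.2] with y hy
    exact haff y (Ioo_subset_Icc_self hy)
  rw [hd.unique hd2]
  ring

lemma aux_mid {v v' : ℝ → ℝ} (hv : IsH1 v v') {α β δ γ : ℝ} (k : ℕ) (h0 : 0 < α) (hαβ : α ≤ β)
    (h1 : β < 1)
    (hcos : ∀ r ∈ Set.Icc α β, γ + δ * Real.log r ∈ Set.Ioo (-(π/2)) (π/2)) :
    α ^ (k + 1) * (((k : ℝ) + 1) / 2 + δ * Real.tan (γ + δ * Real.log α)) * v α ^ 2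
      - β ^ (k + 1) * (((k : ℝ) + 1) / 2 + δ * Real.tan (γ + δ * Real.log β)) * v β ^ 2
    ≤ (∫ r in α..β, r ^ (k + 2) * v' r ^ 2)
      - (((k : ℝ) + 1) ^ 2 / 4 + δ ^ 2) * ∫ r in α..β, r ^ k * v r ^ 2 := by
  set w : ℝ → ℝ := fun x => v 0 + ∫ t in (0:ℝ)..x, v' t with hw
  have hvw : ∀ x ∈ Set.Icc (0:ℝ) 1, v x = w x := hv.2.2.2
  have hsub : Set.uIcc α β ⊆ Set.uIcc 0 1 := by
    rw [uIcc_of_le hαβ, uIcc_of_le zero_le_one]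
    exact Icc_subset_Icc h0.le h1.le
  have hsub' : Set.Icc α β ⊆ Set.Icc 0 1 := Icc_subset_Icc h0.le h1.le
  have hwac : AbsolutelyContinuousOnInterval w α β := by
    have e1 := hv.2.1.absolutelyContinuousOnInterval_intervalIntegral (c := 0) (by simp)
    have e2 : AbsolutelyContinuousOnInterval (fun _ : ℝ => v 0) 0 1 :=
      (contDiff_const.contDiffOn (n := 1)).absolutelyContinuousOnInterval
    exact (e2.add e1).mono hsub
  set p : ℝ → ℝ := fun r => ((k : ℝ) + 1) / 2 + δ * Real.tan (γ + δ * Real.log r) with hp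
  set P : ℝ → ℝ := fun r => r ^ (k + 1) * p r with hP
  have hc : ∀ r ∈ Set.Icc α β, Real.cos (γ + δ * Real.log r) ≠ 0 := fun r hr =>
    (Real.cos_pos_of_mem_Ioo (hcos r hr)).ne'
  have hpos : ∀ r ∈ Set.Icc α β, 0 < r := fun r hr => lt_of_lt_of_le h0 hr.1
  have hPcd : ContDiffOn ℝ 1 P (Set.uIcc α β) := by
    rw [uIcc_of_le hαβ]
    intro r hr
    refine ContDiffAt.contDiffWithinAt ?_
    have t1 : ContDiffAt ℝ 1 (fun r => γ + δ * Real.log r) r :=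
      contDiffAt_const.add (contDiffAt_const.mul (Real.contDiffAt_log.2 (hpos r hr).ne'))
    have t2 : ContDiffAt ℝ 1 (fun r => Real.tan (γ + δ * Real.log r)) r :=
      ContDiffAt.comp (g := Real.tan) r (Real.contDiffAt_tan.2 (hc r hr)) t1
    exact (contDiffAt_id.pow _).mul (contDiffAt_const.add (contDiffAt_const.mul t2))
  have hPac := hPcd.absolutelyContinuousOnInterval
  have hpder : ∀ r ∈ Set.Icc α β, HasDerivAt P (((k : ℝ) + 1) * r ^ k * p r
      + r ^ k * (δ ^ 2 * (1 + Real.tan (γ + δ * Real.log r) ^ 2))) r := by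
    intro r hr
    have hr0 := (hpos r hr).ne'
    have t1 : HasDerivAt (fun r => γ + δ * Real.log r) (δ * r⁻¹) r :=
      ((Real.hasDerivAt_log hr0).const_mul δ).const_add γ
    have t2 := (Real.hasDerivAt_tan (hc r hr)).comp r t1
    have t3 := (hasDerivAt_pow (k + 1) r).mul ((t2.const_mul δ).const_add (((k : ℝ) + 1) / 2))
    refine t3.congr_deriv ?_
    have hcs : 1 / Real.cos (γ + δ * Real.log r) ^ 2 = 1 + Real.tan (γ + δ * Real.log r) ^ 2 := by
      rw [← Real.inv_one_add_tan_sq (hc r hr)]; simp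
    rw [hcs]
    simp only [hp, Nat.add_sub_cancel, Function.comp]
    push_cast
    field_simp
    ring
  have hFac := (hPac.mul hwac).mul hwac
  have hint := hFac.integral_deriv_eq_sub
  have hFint := hFac.intervalIntegrable_deriv
  set F : ℝ → ℝ := P * w * w with hF
  have hI1 : IntervalIntegrable (fun r => r ^ (k + 2) * v' r ^ 2) volume α β :=
    ((aux_sqint hv).mono_set hsub).continuousOn_mul (by fun_prop)
  have hvc : ContinuousOn v (Set.uIcc α β) := by
    rw [uIcc_of_le hαβ]; exact hv.1.mono hsub'
  have hI2 : IntervalIntegrable (fun r => r ^ k * v r ^ 2) volume α β :=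
    ContinuousOn.intervalIntegrable (by fun_prop)
  have hne : ∀ᵐ x : ℝ, x ≠ β := by simp [ae_iff, measure_singleton]
  have key : 0 ≤ ∫ r in α..β, ((r ^ (k + 2) * v' r ^ 2
      - (((k : ℝ) + 1) ^ 2 / 4 + δ ^ 2) * (r ^ k * v r ^ 2)) + deriv F r) := by
    apply intervalIntegral.integral_nonneg_of_ae_restrict hαβ
    rw [Filter.EventuallyLE, ae_restrict_iff' measurableSet_Icc]
    have hne' : ∀ᵐ x : ℝ, x ≠ α := by simp [ae_iff, measure_singleton]
    filter_upwards [aux_ae hv] with x hx hxm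
    have hx0 := hpos x hxm
    have hd := hx ⟨hx0, lt_of_le_of_lt hxm.2 h1⟩
    have hdw : HasDerivAt w (v' x) x := by
      refine hd.congr_of_eventuallyEq ?_
      filter_upwards [Ioo_mem_nhds hx0 (lt_of_le_of_lt hxm.2 h1)] with y hy
      exact (hvw y (Ioo_subset_Icc_self hy)).symm
    have hdF := ((hpder x hxm).mul hdw).mul hdw
    rw [← hF] at hdF
    rw [hdF.deriv]
    rw [hvw x (hsub' hxm)]
    simp only [hP, Pi.mul_apply, Pi.zero_apply]
    have hsq : 0 ≤ x ^ k * (x * v' x + p x * w x) ^ 2 := by positivity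
    refine hsq.trans (le_of_eq ?_)
    simp only [hp]
    ring
  rw [intervalIntegral.integral_add (hI1.sub (hI2.const_mul _)) hFint,
    intervalIntegral.integral_sub hI1 (hI2.const_mul _), intervalIntegral.integral_const_mul,
    hint] at key
  have ha : w α = v α := (hvw α ⟨h0.le, by linarith⟩).symm
  have hb : w β = v β := (hvw β ⟨by linarith, h1.le⟩).symm
  simp only [hF, Pi.mul_apply, ha, hb, hP] at key
  simp only [hp] at key
  nlinarith [key]

lemma aux_quad (N l p A b : ℝ) (hN : 3 ≤ N) (hl : 0 ≤ l) (hD : 0 ≤ (N - 2) * (N - 1) - 2 * l)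
    (hE : ((N - 2) * (N - 1) - 2 * l) * (1 - l + N * p)
      = ((N - 2) / (N - 1)) * (l + N - 1) ^ 2) :
    0 ≤ ((1 - l) / N + p) * A ^ 2 + 2 * (p - l / (N - 1)) * A * b + (p - l / (N - 2)) * b ^ 2 := by
  have hN0 : 0 < N := by linarith
  have hN1 : 0 < N - 1 := by linarith
  have hN2 : 0 < N - 2 := by linarith
  have hR : 0 < ((N - 2) / (N - 1)) * (l + N - 1) ^ 2 := by
    have : 0 < l + N - 1 := by linarith
    positivity
  have ha' : 0 < 1 - l + N * p := by
    rw [← hE] at hR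
    exact pos_of_mul_pos_right hR hD
  have ha : 0 < (1 - l) / N + p := by
    have : (1 - l) / N + p = (1 - l + N * p) / N := by field_simp
    rw [this]; positivity
  have hE' : ((N - 2) * (N - 1) - 2 * l) * (1 - l + N * p) * (N - 1)
      = (N - 2) * (l + N - 1) ^ 2 := by
    rw [hE]; field_simp
  have hdisc : ((1 - l) / N + p) * (p - l / (N - 2)) = (p - l / (N - 1)) ^ 2 := by
    field_simp
    have h3 : N * (p * (((N - 2) * (N - 1) - 2 * l)) * (N - 1) - l * ((N - 1) ^ 2 - l)) = 0 := by
      linear_combination hE'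
    have h4 := (mul_eq_zero.1 h3).resolve_left hN0.ne'
    linear_combination h4
  have hm : 0 ≤ ((1 - l) / N + p) * (((1 - l) / N + p) * A ^ 2
      + 2 * (p - l / (N - 1)) * A * b + (p - l / (N - 2)) * b ^ 2) := by
    have : ((1 - l) / N + p) * (((1 - l) / N + p) * A ^ 2
      + 2 * (p - l / (N - 1)) * A * b + (p - l / (N - 2)) * b ^ 2)
      = (((1 - l) / N + p) * A + (p - l / (N - 1)) * b) ^ 2 := by
      linear_combination b ^ 2 * hdisc
    rw [this]; positivity
  exact nonneg_of_mul_nonneg_right hm ha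

lemma aux_int_affine {v : ℝ → ℝ} {α β a b : ℝ} (k : ℕ) (hαβ : α ≤ β)
    (haff : ∀ x ∈ Set.Icc α β, v x = a * x + b) :
    ∫ r in α..β, r ^ k * v r ^ 2 = a ^ 2 * (∫ r in α..β, r ^ (k + 2))
      + 2 * a * b * (∫ r in α..β, r ^ (k + 1)) + b ^ 2 * ∫ r in α..β, r ^ k := by
  have e : ∫ r in α..β, r ^ k * v r ^ 2 = ∫ r in α..β,
      ((a ^ 2 * r ^ (k + 2) + 2 * a * b * r ^ (k + 1)) + b ^ 2 * r ^ k) := by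
    apply intervalIntegral.integral_congr
    intro x hx
    rw [uIcc_of_le hαβ] at hx
    simp only [haff x hx]
    ring
  rw [e, intervalIntegral.integral_add, intervalIntegral.integral_add,
    intervalIntegral.integral_const_mul, intervalIntegral.integral_const_mul,
    intervalIntegral.integral_const_mul]
  all_goals exact Continuous.intervalIntegrable (by fun_prop) _ _

lemma aux_main (k : ℕ) (h δ γ : ℝ) (hh0 : 0 < h) (hh1 : h < 1/2)
    (hsol : SolvesSystem (k + 3) h δ γ) (v v' : ℝ → ℝ) (hv : MemWh h v v') :
    (((k : ℝ) + 1) ^ 2 / 4 + δ ^ 2) * (∫ r in (0:ℝ)..1, r ^ k * (v r) ^ 2)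
      ≤ ∫ r in (0:ℝ)..1, r ^ (k + 2) * (v' r) ^ 2 := by
  obtain ⟨hH, hv1, ⟨a, b, hL⟩, ⟨c, d, hR⟩⟩ := hv
  obtain ⟨hδ, hδ2, hcos, hE1, hE2⟩ := hsol
  have hk : (0:ℝ) ≤ k := Nat.cast_nonneg k
  have hmid := aux_mid hH k hh0 (by linarith : h ≤ 1 - h) (by linarith) hcos
  have hs : ∀ x y : ℝ, 0 ≤ x → x ≤ y → y ≤ 1 → Set.uIcc x y ⊆ Set.uIcc 0 1 := by
    intro x y hx hxy hy
    rw [uIcc_of_le hxy, uIcc_of_le zero_le_one]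
    exact Icc_subset_Icc hx hy
  have hI1 : IntervalIntegrable (fun r => r ^ (k + 2) * v' r ^ 2) volume 0 1 :=
    (aux_sqint hH).continuousOn_mul (by fun_prop)
  have hvc : ContinuousOn v (Set.uIcc 0 1) := by
    rw [uIcc_of_le zero_le_one]; exact hH.1
  have hI2 : IntervalIntegrable (fun r => r ^ k * v r ^ 2) volume 0 1 :=
    ContinuousOn.intervalIntegrable (by fun_prop)
  have split : ∀ f : ℝ → ℝ, IntervalIntegrable f volume 0 1 →
      ∫ r in (0:ℝ)..1, f r = (∫ r in (0:ℝ)..h, f r) + (∫ r in h..(1 - h), f r)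
        + ∫ r in (1 - h)..1, f r := by
    intro f hf
    have i1 := hf.mono_set (hs 0 h le_rfl hh0.le (by linarith))
    have i2 := hf.mono_set (hs h (1 - h) hh0.le (by linarith) (by linarith))
    have i3 := hf.mono_set (hs (1 - h) 1 (by linarith) (by linarith) le_rfl)
    rw [intervalIntegral.integral_add_adjacent_intervals i1 i2,
      intervalIntegral.integral_add_adjacent_intervals (i1.trans i2) i3]
  rw [split _ hI1, split _ hI2]
  rw [aux_affine hH (k + 2) le_rfl hh0.le (by linarith) hL,
    aux_affine hH (k + 2) (by linarith) (by linarith) le_rfl hR,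
    aux_int_affine k hh0.le hL, aux_int_affine k (by linarith) hR]
  have hd : d = -c := by
    have := hR 1 ⟨by linarith, le_rfl⟩
    rw [hv1] at this; linarith
  subst hd
  have hvh : v h = a * h + b := hL h ⟨hh0.le, le_rfl⟩
  have hvr : v (1 - h) = -(c * h) := by
    rw [hR (1 - h) ⟨le_rfl, by linarith⟩]; ring
  rw [hvh, hvr] at hmid
  set l : ℝ := ((k : ℝ) + 1) ^ 2 / 4 + δ ^ 2 with hl
  set p : ℝ := ((k : ℝ) + 1) / 2 + δ * Real.tan (γ + δ * Real.log h) with hp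
  set q : ℝ := ((k : ℝ) + 1) / 2 + δ * Real.tan (γ + δ * Real.log (1 - h)) with hq
  -- left piece
  have hquad := aux_quad ((k : ℝ) + 3) l p (a * h) b (by linarith) (by positivity)
    (by push_cast at hδ2; rw [hl]; nlinarith)
    (by
      push_cast at hE1
      have hlδ : δ ^ 2 = l - ((k : ℝ) + 1) ^ 2 / 4 := by rw [hl]; ring
      have htp : δ * Real.tan (γ + δ * Real.log h) = p - ((k : ℝ) + 1) / 2 := by rw [hp]; ring
      have e2 : ((k : ℝ) + 3) ^ 2 / 4 - δ ^ 2
          + ((k : ℝ) + 3) * δ * Real.tan (γ + δ * Real.log h)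
          = 1 - l + ((k : ℝ) + 3) * p := by
        rw [mul_assoc, htp, hlδ]; ring
      have e3 : ((k : ℝ) + 3) ^ 2 / 4 + δ ^ 2 = l + ((k : ℝ) + 3) - 1 := by
        rw [hlδ]; ring
      have e4 : (((k : ℝ) + 3) ^ 2 - 2 * ((k : ℝ) + 3)) / 2 - 2 * δ ^ 2
        = ((k : ℝ) + 3 - 2) * ((k : ℝ) + 3 - 1) - 2 * l := by
        rw [hlδ]; ring
      rw [e2, e3, e4] at hE1
      exact hE1)
  have hhp : 0 < h ^ (k + 1) := by positivity
  have hleft := mul_nonneg hhp.le hquad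
  -- right piece
  have f1 := aux_fm (k + 3) (k + 3) (by omega) (by omega) h (by linarith)
  have f2 := aux_fm (k + 3) (k + 3 - 1) (by omega) (by omega) h (by linarith)
  have f3 := aux_fm (k + 3) (k + 3 - 2) (by omega) (by omega) h (by linarith)
  have hq2 : h * q = fm (k + 3) (k + 3) h - gn (k + 3) h * l := by
    have t1 : ((k + 3 : ℕ) : ℝ) - 2 = (k : ℝ) + 1 := by push_cast; ring
    rw [t1] at hE2
    rw [hq, hE2, hl]; field_simp
  unfold gn at hq2
  rw [show k + 3 - 2 = k + 1 by omega] at *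
  rw [show k + 3 - 1 = k + 2 by omega] at *
  simp only [integral_pow]
  push_cast at f1 f2 f3 ⊢
  have g1 : (1 - (1 - h) ^ (k + 3)) / ((k : ℝ) + 3)
    = h * (1 - h) ^ (k + 1) * fm (k + 3) (k + 3) h := f1.symm
  have hright : (1 - h) ^ (k + 1) * q * (-(c * h)) ^ 2
      = c ^ 2 * ((1 - (1 - h) ^ (k + 3)) / ((k : ℝ) + 3)
        - l * ((1 - (1 - h) ^ (k + 3)) / ((k : ℝ) + 3)
          - 2 * ((1 - (1 - h) ^ (k + 2)) / ((k : ℝ) + 2))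
          + (1 - (1 - h) ^ (k + 1)) / ((k : ℝ) + 1))) := by
    rw [← f1, ← f2, ← f3]
    linear_combination (1 - h) ^ (k + 1) * c ^ 2 * h * hq2
  rw [hright] at hmid
  have n1 : (k : ℝ) + 3 - 1 = k + 2 := by ring
  have n2 : (k : ℝ) + 3 - 2 = k + 1 := by ring
  have n3 : (k : ℝ) + 2 + 1 = k + 3 := by ring
  have n4 : (k : ℝ) + 1 + 1 = k + 2 := by ring
  rw [n1, n2] at hleft
  rw [n3, n4]
  simp only [one_pow, zero_pow (Nat.succ_ne_zero _), sub_zero]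
  have z1 : h ^ (k + 2 + 1) / ((k : ℝ) + 3) = h ^ (k + 1) * (h ^ 2 / ((k : ℝ) + 3)) := by ring
  have z2 : h ^ (k + 1 + 1) / ((k : ℝ) + 2) = h ^ (k + 1) * (h / ((k : ℝ) + 2)) := by ring
  have z3 : h ^ (k + 1) / ((k : ℝ) + 1) = h ^ (k + 1) * (1 / ((k : ℝ) + 1)) := by ring
  have hL2 : 0 ≤ a ^ 2 * (h ^ (k + 2 + 1) / ((k : ℝ) + 3))
      - l * (a ^ 2 * (h ^ (k + 2 + 1) / ((k : ℝ) + 3))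
        + 2 * a * b * (h ^ (k + 1 + 1) / ((k : ℝ) + 2)) + b ^ 2 * (h ^ (k + 1) / ((k : ℝ) + 1)))
      + h ^ (k + 1) * p * (a * h + b) ^ 2 := by
    refine hleft.trans (le_of_eq ?_)
    rw [z1, z2, z3]
    ring
  linarith
/-- If `(δ,γ)` solves the system at `(n,h)`, then every `v ∈ W_h` satisfies
`∫₀¹ r^{n−1} v'² ≥ (S^n + δ²)·∫₀¹ r^{n−3} v²`; in particular `μ_h^n ≥ S^n + δ²`. -/
theorem Wh_hardy_lower_bound (n : ℕ) (hn : 3 ≤ n) (h δ γ : ℝ) (hh0 : 0 < h) (hh1 : h < 1/2)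
    (hsol : SolvesSystem n h δ γ) :
    (∀ v v' : ℝ → ℝ, MemWh h v v' →
      (∫ r in (0:ℝ)..1, r ^ (n - 1) * (v' r) ^ 2)
        ≥ (((n : ℝ) - 2) ^ 2 / 4 + δ ^ 2) * ∫ r in (0:ℝ)..1, r ^ (n - 3) * (v r) ^ 2) ∧
    munh n h ≥ ((n : ℝ) - 2) ^ 2 / 4 + δ ^ 2 := by
  obtain ⟨k, rfl⟩ : ∃ k, n = k + 3 := ⟨n - 3, by omega⟩
  have t1 : ((k + 3 : ℕ) : ℝ) - 2 = (k : ℝ) + 1 := by push_cast; ring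
  rw [t1, show k + 3 - 1 = k + 2 by omega, show k + 3 - 3 = k by omega]
  have hmain := aux_main k h δ γ hh0 hh1 hsol
  refine ⟨fun v v' hv => hmain v v' hv, ?_⟩
  unfold munh
  rw [show k + 3 - 1 = k + 2 by omega, show k + 3 - 3 = k by omega]
  apply le_csInf
  · refine ⟨_, fun x => 1 - x, fun _ => -1, ⟨⟨by fun_prop, by simp, by simp, ?_⟩, by simp,
      ⟨-1, 1, fun x _ => by ring⟩, ⟨-1, 1, fun x _ => by ring⟩⟩, ⟨0, by simp, by simp⟩, rfl⟩
    intro x _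
    simp
    ring
  · rintro s ⟨v, v', hv, ⟨x, hx, hvx⟩, rfl⟩
    have hvc : ContinuousOn v (Set.Icc 0 1) := hv.1.1
    have hpos : 0 < ∫ r in (0:ℝ)..1, r ^ k * v r ^ 2 := by
      have hex : ∃ y ∈ Set.Ioc (0:ℝ) 1, v y ≠ 0 := by
        by_contra hcon
        push Not at hcon
        have hx0 : x = 0 := by
          by_contra hne
          exact hvx (hcon x ⟨lt_of_le_of_ne hx.1 (Ne.symm hne), hx.2⟩)
        subst hx0
        obtain ⟨a, b, hab⟩ := hv.2.2.1
        have e0 := hab 0 ⟨le_rfl, hh0.le⟩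
        have e1 := hab h ⟨hh0.le, le_rfl⟩
        have e2 := hab (h / 2) ⟨by linarith, by linarith⟩
        rw [hcon h ⟨hh0, by linarith⟩] at e1
        rw [hcon (h / 2) ⟨by linarith, by linarith⟩] at e2
        apply hvx
        rw [e0]
        linarith
      obtain ⟨y, hy, hvy⟩ := hex
      refine intervalIntegral.integral_pos zero_lt_one (by fun_prop) ?_
        ⟨y, Ioc_subset_Icc_self hy, ?_⟩
      · intro r hr
        have := hr.1
        positivity
      · have := hy.1
        positivity
    rw [le_div_iff₀ hpos]
    exact hmain v v' hv
end
end

section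
/- Fix an integer n ≥ 3. There exists a constant C > 0 such that the following holds for every positive integer N (with h = 1/N), every integer m with 1 ≤ m < N (with ε = m·h), and every continuous f : [0,1] → ℝ with f(1) = 0 that vanishes on [0,ε], belongs to H¹(0,1) with derivative f', and whose derivative is absolutely continuous on [ε,1] with second derivative f'' ∈ L²(ε,1). Setting E_h(f) = (h/ε^{(n+1)/2})·(∫₀¹ f'(r)²·r^{n−1} dr)^{1/2}·(∫_ε¹ f''(r)²·r^{n+1} dr)^{1/2} + (h²/ε^{n+1})·∫_ε¹ f''(r)²·r^{n+1} dr, one has ∫₀¹ ((Π_h f)'(r))²·r^{n−1} dr ≤ ∫₀¹ f'(r)²·r^{n−1} dr + C·E_h(f) and ∫₀¹ (Π_h f)(r)²·r^{n−3} dr ≥ ∫₀¹ f(r)²·r^{n−3} dr − C·E_h(f). -/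
open MeasureTheory Real Set Filter

noncomputable section

/-- The piecewise-linear interpolation operator `Π_h` on the uniform mesh with
nodes `i/N`: on `[i/N, (i+1)/N)` it is the affine interpolant of the nodal values. -/
def interp (N : ℕ) (f : ℝ → ℝ) : ℝ → ℝ := fun x =>
  f ((⌊x * (N : ℝ)⌋ : ℝ) / (N : ℝ)) +
    (x - (⌊x * (N : ℝ)⌋ : ℝ) / (N : ℝ)) *
      ((f (((⌊x * (N : ℝ)⌋ : ℝ) + 1) / (N : ℝ)) - f ((⌊x * (N : ℝ)⌋ : ℝ) / (N : ℝ))) * (N : ℝ))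

/-- Cauchy-Schwarz with a weight, on an interval. -/
lemma weighted_cs {a b : ℝ} (hab : a ≤ b) {u v w : ℝ → ℝ}
    (hu : AEStronglyMeasurable u (volume.restrict (Ioc a b)))
    (hv : AEStronglyMeasurable v (volume.restrict (Ioc a b)))
    (hw : Continuous w) (hw0 : ∀ x ∈ Ioc a b, 0 ≤ w x)
    (hu2 : IntervalIntegrable (fun x => u x ^ 2 * w x) volume a b)
    (hv2 : IntervalIntegrable (fun x => v x ^ 2 * w x) volume a b)
    {α β : ℝ} (hα : 0 ≤ α) (hβ : 0 ≤ β)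
    (hαu : ∫ x in a..b, u x ^ 2 * w x ≤ α ^ 2) (hβv : ∫ x in a..b, v x ^ 2 * w x ≤ β ^ 2) :
    IntervalIntegrable (fun x => u x * v x * w x) volume a b ∧
      |∫ x in a..b, u x * v x * w x| ≤ α * β := by
  have hint : IntervalIntegrable (fun x => u x * v x * w x) volume a b := by
    refine (hu2.add hv2).mono_fun' ?_ ?_
    · rw [uIoc_of_le hab]
      exact (hu.mul hv).mul hw.aestronglyMeasurable
    · rw [uIoc_of_le hab]
      refine ae_restrict_of_forall_mem measurableSet_Ioc fun x hx => ?_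
      have h0 := hw0 x hx
      simp only [norm_mul, Real.norm_eq_abs, abs_of_nonneg h0]
      rw [← add_mul]
      refine mul_le_mul_of_nonneg_right ?_ h0
      nlinarith [sq_nonneg (|u x| - |v x|), sq_abs (u x), sq_abs (v x), sq_nonneg (u x),
        sq_nonneg (v x)]
  refine ⟨hint, ?_⟩
  have key : ∀ t : ℝ, 0 ≤ (∫ x in a..b, u x ^ 2 * w x) * (t * t)
      + (2 * ∫ x in a..b, u x * v x * w x) * t + ∫ x in a..b, v x ^ 2 * w x := by
    intro t
    have e : (∫ x in a..b, (t * u x + v x) ^ 2 * w x) = (∫ x in a..b, u x ^ 2 * w x) * (t * t)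
      + (2 * ∫ x in a..b, u x * v x * w x) * t + ∫ x in a..b, v x ^ 2 * w x := by
      have : (fun x => (t * u x + v x) ^ 2 * w x) = fun x => ((t * t) * (u x ^ 2 * w x) +
          (2 * t) * (u x * v x * w x)) + v x ^ 2 * w x := by
        funext x; ring
      rw [this, intervalIntegral.integral_add ((hu2.const_mul _).add (hint.const_mul _)) hv2,
        intervalIntegral.integral_add (hu2.const_mul _) (hint.const_mul _),
        intervalIntegral.integral_const_mul, intervalIntegral.integral_const_mul]
      ring
    rw [← e, intervalIntegral.integral_of_le hab]
    exact setIntegral_nonneg measurableSet_Ioc fun x hx => mul_nonneg (sq_nonneg _) (hw0 x hx)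
  have hd := discrim_le_zero key
  have hU : 0 ≤ ∫ x in a..b, u x ^ 2 * w x := by
    rw [intervalIntegral.integral_of_le hab]
    exact setIntegral_nonneg measurableSet_Ioc fun x hx => mul_nonneg (sq_nonneg _) (hw0 x hx)
  have hV : 0 ≤ ∫ x in a..b, v x ^ 2 * w x := by
    rw [intervalIntegral.integral_of_le hab]
    exact setIntegral_nonneg measurableSet_Ioc fun x hx => mul_nonneg (sq_nonneg _) (hw0 x hx)
  unfold discrim at hd
  refine abs_le_of_sq_le_sq ?_ (by positivity)
  have := mul_le_mul hαu hβv hV (by positivity)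
  nlinarith

/-- Cauchy-Schwarz against the constant one. -/
lemma sq_integral_le {a b x y : ℝ} (hax : a ≤ x) (hxy : x ≤ y) (hyb : y ≤ b) {g : ℝ → ℝ}
    (hg : IntervalIntegrable g volume a b)
    (hg2 : IntervalIntegrable (fun t => g t ^ 2) volume a b) :
    (∫ t in x..y, g t) ^ 2 ≤ (b - a) * ∫ t in a..b, g t ^ 2 := by
  have hab : a ≤ b := by linarith
  have hsub : uIcc x y ⊆ uIcc a b := by
    rw [uIcc_of_le hxy, uIcc_of_le hab]; exact Icc_subset_Icc hax hyb
  have g1 := hg.mono_set hsub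
  have g2 := hg2.mono_set hsub
  have hK : 0 ≤ ∫ t in a..b, g t ^ 2 :=
    intervalIntegral.integral_nonneg hab fun _ _ => sq_nonneg _
  have hK' : ∫ t in x..y, g t ^ 2 ≤ ∫ t in a..b, g t ^ 2 :=
    intervalIntegral.integral_mono_interval hax hxy hyb
      (Eventually.of_forall fun _ => sq_nonneg _) hg2
  have h := (weighted_cs hxy (u := fun _ => 1) (v := g) (w := fun _ => 1)
    (α := √(b - a)) (β := √(∫ t in a..b, g t ^ 2))
    aestronglyMeasurable_const g1.1.aestronglyMeasurable continuous_const (by simp)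
    (by simp) (by simpa using g2) (sqrt_nonneg _) (sqrt_nonneg _)
    (by rw [sq_sqrt (by linarith)]; simp; linarith)
    (by rw [sq_sqrt hK]; simpa using hK')).2
  simp only [one_mul, mul_one] at h
  have h2 := pow_le_pow_left₀ (abs_nonneg _) h 2
  rwa [sq_abs, mul_pow, sq_sqrt (by linarith), sq_sqrt hK] at h2

/-- Local estimates on one cell. -/
lemma cell_est {a b : ℝ} (hab : a < b) {f f' f'' : ℝ → ℝ}
    (hfc : ContinuousOn f (Icc a b)) (hfd : ∀ x ∈ Ioo a b, HasDerivAt f (f' x) x)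
    (hf' : ∀ x ∈ Icc a b, ∀ y ∈ Icc a b, f' y - f' x = ∫ t in x..y, f'' t)
    (hg : IntervalIntegrable f'' volume a b)
    (hg2 : IntervalIntegrable (fun t => f'' t ^ 2) volume a b) :
    (∀ x ∈ Ioo a b, ((f b - f a) / (b - a) - f' x) ^ 2 ≤ (b - a) * ∫ t in a..b, f'' t ^ 2) ∧
    (∀ x ∈ Ioo a b, (f a + (x - a) * ((f b - f a) / (b - a)) - f x) ^ 2
      ≤ (b - a) ^ 2 * ((b - a) * ∫ t in a..b, f'' t ^ 2)) := by
  have h1 : ∀ x ∈ Ioo a b,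
      ((f b - f a) / (b - a) - f' x) ^ 2 ≤ (b - a) * ∫ t in a..b, f'' t ^ 2 := by
    intro x hx
    obtain ⟨c, hc, hce⟩ := exists_hasDerivAt_eq_slope f f' hab hfc hfd
    rw [← hce]
    rcases le_total x c with hxc | hxc
    · rw [hf' x (Ioo_subset_Icc_self hx) c (Ioo_subset_Icc_self hc)]
      exact sq_integral_le hx.1.le hxc hc.2.le hg hg2
    · have : (f' c - f' x) ^ 2 = (f' x - f' c) ^ 2 := by ring
      rw [this, hf' c (Ioo_subset_Icc_self hc) x (Ioo_subset_Icc_self hx)]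
      exact sq_integral_le hc.1.le hxc hx.2.le hg hg2
  refine ⟨h1, fun x hx => ?_⟩
  obtain ⟨c, hc, hce⟩ := exists_hasDerivAt_eq_slope f f' hx.1
    (hfc.mono (Icc_subset_Icc le_rfl hx.2.le))
    (fun y hy => hfd y ⟨hy.1, hy.2.trans hx.2⟩)
  have hxa : x - a ≠ 0 := by linarith [hx.1]
  have e : f a + (x - a) * ((f b - f a) / (b - a)) - f x
      = (x - a) * ((f b - f a) / (b - a) - f' c) := by
    rw [hce, mul_sub, mul_div_cancel₀ _ hxa]; ring
  rw [e, mul_pow]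
  have h3 : (x - a) ^ 2 ≤ (b - a) ^ 2 :=
    pow_le_pow_left₀ (by linarith [hx.1]) (by linarith [hx.2]) 2
  exact mul_le_mul h3 (h1 c ⟨hc.1, hc.2.trans hx.2⟩) (sq_nonneg _) (sq_nonneg _)

/-- The Hardy inequality. -/
lemma hardy_est {ε : ℝ} (h0 : 0 < ε) (h1 : ε ≤ 1) (k : ℕ) {f f' : ℝ → ℝ}
    (hfc : ContinuousOn f (Icc ε 1)) (hfc' : ContinuousOn f' (Icc ε 1))
    (hfd : ∀ x ∈ Ioo ε 1, HasDerivAt f (f' x) x) (hfε : f ε = 0) (hf1 : f 1 = 0)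
    {A : ℝ} (hA : 0 ≤ A) (hAf : ∫ r in ε..1, f' r ^ 2 * r ^ (k + 2) ≤ A ^ 2) :
    ∫ r in ε..1, f r ^ 2 * r ^ k ≤ (2 * A) ^ 2 := by
  have hu : uIcc ε 1 = Icc ε 1 := uIcc_of_le h1
  have i1 : IntervalIntegrable (fun r => f r ^ 2 * r ^ k) volume ε 1 := by
    apply ContinuousOn.intervalIntegrable; rw [hu]; fun_prop
  have i2 : IntervalIntegrable (fun r => f r * (f' r * r) * r ^ k) volume ε 1 := by
    apply ContinuousOn.intervalIntegrable; rw [hu]; fun_prop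
  have i3 : IntervalIntegrable (fun r => (f' r * r) ^ 2 * r ^ k) volume ε 1 := by
    apply ContinuousOn.intervalIntegrable; rw [hu]; fun_prop
  have hX : 0 ≤ ∫ r in ε..1, f r ^ 2 * r ^ k :=
    intervalIntegral.integral_nonneg h1 fun x hx =>
      mul_nonneg (sq_nonneg _) (pow_nonneg (h0.le.trans hx.1) _)
  have ftc := intervalIntegral.integral_eq_sub_of_hasDerivAt_of_le h1
    (f := fun r => f r ^ 2 * r ^ (k + 1))
    (f' := fun r => 2 * (f r * (f' r * r) * r ^ k) + (k + 1) * (f r ^ 2 * r ^ k))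
    (by fun_prop)
    (by
      intro x hx
      have := ((hfd x hx).pow 2).mul (hasDerivAt_pow (k + 1) x)
      refine HasDerivAt.congr_deriv this ?_
      simp only [Nat.cast_add, Nat.cast_one, Nat.cast_ofNat, Nat.add_sub_cancel, Pi.pow_apply]
      ring)
    ((i2.const_mul _).add (i1.const_mul _))
  rw [intervalIntegral.integral_add (i2.const_mul _) (i1.const_mul _),
    intervalIntegral.integral_const_mul, intervalIntegral.integral_const_mul, hfε, hf1] at ftc
  have meas : ∀ g : ℝ → ℝ, ContinuousOn g (Icc ε 1) →
      AEStronglyMeasurable g (volume.restrict (Ioc ε 1)) := fun g hg =>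
    (hg.mono Ioc_subset_Icc_self).aestronglyMeasurable measurableSet_Ioc
  have cs := (weighted_cs h1 (u := f) (v := fun r => f' r * r) (w := fun r => r ^ k)
    (meas _ hfc) (meas _ (by fun_prop)) (by fun_prop)
    (fun x hx => pow_nonneg (h0.le.trans hx.1.le) _) i1 i3 (sqrt_nonneg _) hA
    (by rw [sq_sqrt hX])
    (by
      refine le_trans (le_of_eq ?_) hAf
      congr 1; funext r; ring)).2
  set X := ∫ r in ε..1, f r ^ 2 * r ^ k
  set Y := ∫ r in ε..1, f r * (f' r * r) * r ^ k
  have hs := sq_sqrt hX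
  have hs0 := sqrt_nonneg X
  have hkX : 0 ≤ (k : ℝ) * X := by positivity
  have hY := (abs_le.1 cs).1
  have : √X * √X ≤ √X * (2 * A) := by nlinarith
  have h5 : √X ≤ 2 * A := by
    rcases hs0.eq_or_lt with h | h
    · rw [← h]; positivity
    · exact le_of_mul_le_mul_left this h
  rw [← hs]; exact pow_le_pow_left₀ hs0 h5 2

lemma perturb_est {a b : ℝ} (hab : a ≤ b) {p q w : ℝ → ℝ}
    (hp : AEStronglyMeasurable p (volume.restrict (Ioc a b)))
    (hq : AEStronglyMeasurable q (volume.restrict (Ioc a b)))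
    (hw : Continuous w) (hw0 : ∀ x ∈ Ioc a b, 0 ≤ w x)
    (hp2 : IntervalIntegrable (fun x => p x ^ 2 * w x) volume a b)
    (hd2 : IntervalIntegrable (fun x => (q x - p x) ^ 2 * w x) volume a b)
    {α β : ℝ} (hα : 0 ≤ α) (hβ : 0 ≤ β)
    (hαp : ∫ x in a..b, p x ^ 2 * w x ≤ α ^ 2)
    (hβd : ∫ x in a..b, (q x - p x) ^ 2 * w x ≤ β ^ 2) :
    IntervalIntegrable (fun x => q x ^ 2 * w x) volume a b ∧
      |(∫ x in a..b, q x ^ 2 * w x) - (∫ x in a..b, p x ^ 2 * w x)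
        - ∫ x in a..b, (q x - p x) ^ 2 * w x| ≤ 2 * (α * β) := by
  obtain ⟨hi, hb⟩ := weighted_cs hab (u := p) (v := fun x => q x - p x) (w := w) hp (hq.sub hp)
    hw hw0 hp2 hd2 hα hβ hαp hβd
  have e : (fun x => q x ^ 2 * w x) = fun x => (p x ^ 2 * w x + 2 * (p x * (q x - p x) * w x))
      + (q x - p x) ^ 2 * w x := by
    funext x; ring
  refine ⟨?_, ?_⟩
  · rw [e]; exact (hp2.add (hi.const_mul 2)).add hd2
  · rw [e, intervalIntegral.integral_add (hp2.add (hi.const_mul 2)) hd2,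
      intervalIntegral.integral_add hp2 (hi.const_mul 2), intervalIntegral.integral_const_mul]
    have : ∀ x y z : ℝ, x + 2 * y + z - x - z = 2 * y := by intros; ring
    rw [this, abs_mul, abs_two]
    linarith

lemma cells_bound {N m : ℕ} (hN : 0 < N) (hmN : m ≤ N) {φ ψ : ℝ → ℝ}
    (hφm : AEStronglyMeasurable φ (volume.restrict (Ioc ((m : ℝ) / N) 1)))
    (hψ : IntervalIntegrable ψ volume ((m : ℝ) / N) 1)
    (hφ0 : ∀ x ∈ Ioc ((m : ℝ) / N) 1, 0 ≤ φ x)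
    (hφ : ∀ i : ℕ, m ≤ i → i < N → ∀ x ∈ Ioo ((i : ℝ) / N) (((i + 1 : ℕ) : ℝ) / N),
      φ x ≤ (1 / (N : ℝ)) * ∫ t in ((i : ℝ) / N)..(((i + 1 : ℕ) : ℝ) / N), ψ t) :
    IntervalIntegrable φ volume ((m : ℝ) / N) 1 ∧
      ∫ t in ((m : ℝ) / N)..1, φ t ≤ (1 / (N : ℝ)) ^ 2 * ∫ t in ((m : ℝ) / N)..1, ψ t := by
  have hNr : (0 : ℝ) < N := by exact_mod_cast hN
  have hmono : ∀ i j : ℕ, i ≤ j → (i : ℝ) / N ≤ (j : ℝ) / N := fun i j hij =>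
    div_le_div_of_nonneg_right (by exact_mod_cast hij) hNr.le
  have hNN : ((N : ℕ) : ℝ) / N = 1 := div_self hNr.ne'
  have hm1 : (m : ℝ) / N ≤ 1 := hNN ▸ hmono m N hmN
  have hsub : ∀ i : ℕ, m ≤ i → i < N →
      Ioc ((i : ℝ) / N) (((i + 1 : ℕ) : ℝ) / N) ⊆ Ioc ((m : ℝ) / N) 1 := fun i h1 h2 =>
    Ioc_subset_Ioc (hmono _ _ h1) (hNN ▸ hmono (i + 1) N h2)
  have hψi : ∀ i ∈ Ico m N,
      IntervalIntegrable ψ volume ((i : ℝ) / N) (((i + 1 : ℕ) : ℝ) / N) := by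
    intro i hi
    refine hψ.mono_set' ?_
    rw [uIoc_of_le hm1, uIoc_of_le (hmono _ _ (Nat.le_succ i))]
    exact hsub i hi.1 hi.2
  have hφi : ∀ i ∈ Ico m N,
      IntervalIntegrable φ volume ((i : ℝ) / N) (((i + 1 : ℕ) : ℝ) / N) := by
    intro i hi
    have hle := hmono _ _ (Nat.le_succ i)
    refine (intervalIntegrable_const (c := (1 / (N : ℝ)) *
      ∫ t in ((i : ℝ) / N)..(((i + 1 : ℕ) : ℝ) / N), ψ t)).mono_fun' ?_ ?_
    · rw [uIoc_of_le hle]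
      exact hφm.mono_set (hsub i hi.1 hi.2)
    · rw [uIoc_of_le hle, ← restrict_Ioo_eq_restrict_Ioc]
      refine ae_restrict_of_forall_mem measurableSet_Ioo fun x hx => ?_
      have := hφ0 x (hsub i hi.1 hi.2 (Ioo_subset_Ioc_self hx))
      simp only [Real.norm_eq_abs, abs_of_nonneg this]
      exact hφ i hi.1 hi.2 x hx
  have hI := IntervalIntegrable.trans_iterate_Ico (a := fun i : ℕ => (i : ℝ) / N) hmN hφi
  have s1 := intervalIntegral.sum_integral_adjacent_intervals_Ico
    (a := fun i : ℕ => (i : ℝ) / N) hmN hφi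
  have s2 := intervalIntegral.sum_integral_adjacent_intervals_Ico
    (a := fun i : ℕ => (i : ℝ) / N) hmN hψi
  simp only [hNN] at hI s1 s2
  refine ⟨hI, ?_⟩
  rw [← s1, ← s2, Finset.mul_sum]
  refine Finset.sum_le_sum fun i hi => ?_
  rw [Finset.mem_Ico] at hi
  have hle := hmono _ _ (Nat.le_succ i)
  refine (intervalIntegral.integral_mono_on_of_le_Ioo hle (hφi i hi) intervalIntegrable_const
    (hφ i hi.1 hi.2)).trans ?_
  rw [intervalIntegral.integral_const, smul_eq_mul]
  apply le_of_eq
  have : ((i + 1 : ℕ) : ℝ) / N - (i : ℝ) / N = 1 / N := by push_cast; ring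
  rw [this]; ring

lemma interp_cell {N : ℕ} (hN : 0 < N) (f : ℝ → ℝ) (i : ℕ) {x : ℝ}
    (hx : x ∈ Ico ((i : ℝ) / N) (((i + 1 : ℕ) : ℝ) / N)) :
    interp N f x = f ((i : ℝ) / N) + (x - (i : ℝ) / N) *
      ((f (((i + 1 : ℕ) : ℝ) / N) - f ((i : ℝ) / N)) /
        (((i + 1 : ℕ) : ℝ) / N - (i : ℝ) / N)) := by
  have hNr : (0 : ℝ) < N := by exact_mod_cast hN
  have hfl : ⌊x * (N : ℝ)⌋ = (i : ℤ) := by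
    rw [Int.floor_eq_iff]
    constructor
    · have := (div_le_iff₀ hNr).1 hx.1
      exact_mod_cast this
    · have := (lt_div_iff₀ hNr).1 hx.2
      push_cast at this ⊢; exact this
  have : ((i + 1 : ℕ) : ℝ) / N - (i : ℝ) / N = 1 / N := by push_cast; ring
  rw [this]
  unfold interp
  rw [hfl]
  push_cast
  rw [div_div_eq_mul_div, div_one]

lemma deriv_interp_cell {N : ℕ} (hN : 0 < N) (f : ℝ → ℝ) (i : ℕ) {x : ℝ}
    (hx : x ∈ Ioo ((i : ℝ) / N) (((i + 1 : ℕ) : ℝ) / N)) :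
    deriv (interp N f) x = (f (((i + 1 : ℕ) : ℝ) / N) - f ((i : ℝ) / N)) /
        (((i + 1 : ℕ) : ℝ) / N - (i : ℝ) / N) := by
  have he : interp N f =ᶠ[nhds x] fun x => f ((i : ℝ) / N) + (x - (i : ℝ) / N) *
      ((f (((i + 1 : ℕ) : ℝ) / N) - f ((i : ℝ) / N)) /
        (((i + 1 : ℕ) : ℝ) / N - (i : ℝ) / N)) := by
    filter_upwards [Ioo_mem_nhds hx.1 hx.2] with y hy
    exact interp_cell hN f i (Ioo_subset_Ico_self hy)
  rw [he.deriv_eq]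
  simp

lemma measurable_interp (N : ℕ) (f : ℝ → ℝ) : Measurable (interp N f) := by
  have hfl : Measurable fun x : ℝ => ⌊x * (N : ℝ)⌋ :=
    Int.measurable_floor.comp (measurable_id.mul_const _)
  have h1 : ∀ g : ℤ → ℝ, Measurable fun x : ℝ => g ⌊x * (N : ℝ)⌋ := fun g =>
    (measurable_from_top (f := g)).comp hfl
  unfold interp
  exact (h1 fun k => f ((k : ℝ) / N)).add ((measurable_id.sub (h1 fun k => (k : ℝ) / N)).mul
    (h1 fun k => (f (((k : ℝ) + 1) / N) - f ((k : ℝ) / N)) * N))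

lemma interp_zero {N m : ℕ} (hN : 0 < N) {f : ℝ → ℝ}
    (hf : ∀ x ∈ Icc (0 : ℝ) ((m : ℝ) / N), f x = 0) {x : ℝ}
    (hx : x ∈ Ico (0 : ℝ) ((m : ℝ) / N)) : interp N f x = 0 := by
  have hNr : (0 : ℝ) < N := by exact_mod_cast hN
  have hxN : 0 ≤ x * N := mul_nonneg hx.1 hNr.le
  have h1 := Nat.floor_le hxN
  have h2 := Nat.lt_floor_add_one (x * N)
  set i := ⌊x * (N : ℝ)⌋₊
  have him : i < m := by
    have := (lt_div_iff₀ hNr).1 hx.2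
    exact_mod_cast lt_of_le_of_lt h1 this
  have hmono : ∀ i j : ℕ, i ≤ j → (i : ℝ) / N ≤ (j : ℝ) / N := fun i j hij =>
    div_le_div_of_nonneg_right (by exact_mod_cast hij) hNr.le
  rw [interp_cell hN f i ⟨(div_le_iff₀ hNr).2 h1, (lt_div_iff₀ hNr).2 (by push_cast; exact h2)⟩,
    hf _ ⟨by positivity, hmono _ _ him⟩, hf _ ⟨by positivity, hmono _ _ him.le⟩]
  simp

/-- Weighted interpolation estimates in dimension `n ≥ 3`: there is `C > 0` such that for
every mesh size `h = 1/N`, every interpolation node `ε = m·h` with `1 ≤ m < N`, and every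
`f ∈ H¹(0,1)` with `f(1) = 0`, vanishing on `[0,ε]`, whose derivative is absolutely
continuous on `[ε,1]` with `f'' ∈ L²(ε,1)`, setting
`E_h(f) = (h/ε^{(n+1)/2})·(∫₀¹ f'² r^{n−1})^½·(∫_ε¹ f''² r^{n+1})^½ + (h²/ε^{n+1})·∫_ε¹ f''² r^{n+1}`,
one has `∫₀¹ ((Π_h f)')² r^{n−1} ≤ ∫₀¹ f'² r^{n−1} + C·E_h(f)` and
`∫₀¹ (Π_h f)² r^{n−3} ≥ ∫₀¹ f² r^{n−3} − C·E_h(f)`. -/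
theorem interp_estimates_nd (n : ℕ) (hn : 3 ≤ n) :
    ∃ C : ℝ, 0 < C ∧ ∀ N : ℕ, 0 < N → ∀ m : ℕ, 1 ≤ m → m < N →
      ∀ h ε : ℝ, h = 1 / (N : ℝ) → ε = (m : ℝ) * h →
      ∀ f f' f'' : ℝ → ℝ,
        IsH1 f f' → f 1 = 0 →
        (∀ x ∈ Set.Icc (0:ℝ) ε, f x = 0) →
        (∀ x ∈ Set.Icc ε 1, f' x = f' ε + ∫ t in ε..x, f'' t) →
        IntervalIntegrable f'' volume ε 1 →
        IntegrableOn (fun t => f'' t ^ 2) (Set.Ioo ε 1) →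
        ∀ E : ℝ,
          E = (h / ε ^ (((n : ℝ) + 1) / 2))
                * Real.sqrt (∫ r in (0:ℝ)..1, (f' r) ^ 2 * r ^ (n - 1))
                * Real.sqrt (∫ r in ε..1, (f'' r) ^ 2 * r ^ (n + 1))
              + (h ^ 2 / ε ^ (n + 1)) * ∫ r in ε..1, (f'' r) ^ 2 * r ^ (n + 1) →
          (∫ r in (0:ℝ)..1, (deriv (interp N f) r) ^ 2 * r ^ (n - 1))
              ≤ (∫ r in (0:ℝ)..1, (f' r) ^ 2 * r ^ (n - 1)) + C * E ∧
          (∫ r in (0:ℝ)..1, (interp N f r) ^ 2 * r ^ (n - 3))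
              ≥ (∫ r in (0:ℝ)..1, (f r) ^ 2 * r ^ (n - 3)) - C * E := by
  obtain ⟨k, rfl⟩ : ∃ k, n = k + 3 := ⟨n - 3, by omega⟩
  refine ⟨4, by norm_num, ?_⟩
  intro N hN m hm hmN h ε hh hε f f' f'' hH1 hf1 hf0 hf'' hg hg2o E hE
  obtain ⟨hfc, hf'i, hf'2o, hfint⟩ := hH1
  simp only [Nat.add_sub_cancel, show k + 3 - 1 = k + 2 from rfl] at hE ⊢
  have hNr : (0 : ℝ) < N := by exact_mod_cast hN
  have hεm : ε = (m : ℝ) / N := by rw [hε, hh]; ring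
  have hmr : (1 : ℝ) ≤ m := by exact_mod_cast hm
  have hε0 : 0 < ε := by rw [hεm]; positivity
  have hε1 : ε ≤ 1 := by
    rw [hεm, div_le_one hNr]; exact_mod_cast hmN.le
  have h0 : 0 < h := by rw [hh]; positivity
  have hh1 : h ≤ 1 := by
    rw [hh, div_le_one hNr]; exact_mod_cast hN
  have hu : uIcc ε 1 = Icc ε 1 := uIcc_of_le hε1
  -- regularity
  have hg2 : IntervalIntegrable (fun t => f'' t ^ 2) volume ε 1 :=
    (intervalIntegrable_iff_integrableOn_Ioo_of_le hε1).2 hg2o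
  have hf'2 : IntervalIntegrable (fun t => f' t ^ 2) volume 0 1 :=
    (intervalIntegrable_iff_integrableOn_Ioo_of_le zero_le_one).2 hf'2o
  have hfc' : ContinuousOn f' (Icc ε 1) := by
    have hp : ContinuousOn (fun x => ∫ t in ε..x, f'' t) (Icc ε 1) := by
      rw [← hu]
      exact intervalIntegral.continuousOn_primitive_interval
        ((intervalIntegrable_iff' (by finiteness)).1 hg)
    exact (continuousOn_const.add hp).congr fun x hx => hf'' x hx
  have hfcε : ContinuousOn f (Icc ε 1) := hfc.mono (Icc_subset_Icc hε0.le le_rfl)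
  have hfd : ∀ x ∈ Ioo ε 1, HasDerivAt f (f' x) x := by
    intro x hx
    have hx0 : 0 < x := hε0.trans hx.1
    have hi : IntervalIntegrable f' volume 0 x := hf'i.mono_set (by
      rw [uIcc_of_le hx0.le, uIcc_of_le zero_le_one]; exact Icc_subset_Icc le_rfl hx.2.le)
    have hco : ContinuousOn f' (Ioo ε 1) := hfc'.mono Ioo_subset_Icc_self
    have hd := intervalIntegral.integral_hasDerivAt_right hi
      (hco.stronglyMeasurableAtFilter isOpen_Ioo x hx)
      (hco.continuousAt (Ioo_mem_nhds hx.1 hx.2))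
    refine (hd.const_add (f 0)).congr_of_eventuallyEq ?_
    filter_upwards [Ioo_mem_nhds hx.1 hx.2] with y hy
    exact hfint y ⟨(hε0.trans hy.1).le, hy.2.le⟩
  have hdiff : ∀ x ∈ Icc ε 1, ∀ y ∈ Icc ε 1, f' y - f' x = ∫ t in x..y, f'' t := by
    intro x hx y hy
    have hi : ∀ z ∈ Icc ε 1, IntervalIntegrable f'' volume ε z := fun z hz =>
      hg.mono_set (by rw [hu, uIcc_of_le hz.1]; exact Icc_subset_Icc le_rfl hz.2)
    rw [hf'' x hx, hf'' y hy, ← intervalIntegral.integral_interval_sub_left (hi y hy) (hi x hx)]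
    ring
  -- abbreviations
  have iA : IntervalIntegrable (fun r => f' r ^ 2 * r ^ (k + 2)) volume 0 1 :=
    hf'2.mul_continuousOn (by fun_prop)
  have hA20 : 0 ≤ ∫ r in (0:ℝ)..1, f' r ^ 2 * r ^ (k + 2) :=
    intervalIntegral.integral_nonneg zero_le_one fun x hx =>
      mul_nonneg (sq_nonneg _) (pow_nonneg hx.1 _)
  have hAε : ∫ r in ε..1, f' r ^ 2 * r ^ (k + 2) ≤ ∫ r in (0:ℝ)..1, f' r ^ 2 * r ^ (k + 2) := by
    refine intervalIntegral.integral_mono_interval hε0.le hε1 le_rfl ?_ iA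
    exact ae_restrict_of_forall_mem measurableSet_Ioc fun x hx =>
      mul_nonneg (sq_nonneg _) (pow_nonneg hx.1.le _)
  set A2 := ∫ r in (0:ℝ)..1, f' r ^ 2 * r ^ (k + 2) with hA2
  have iB : IntervalIntegrable (fun r => f'' r ^ 2 * r ^ (k + 3 + 1)) volume ε 1 :=
    hg2.mul_continuousOn (by fun_prop)
  have hB20 : 0 ≤ ∫ r in ε..1, f'' r ^ 2 * r ^ (k + 3 + 1) :=
    intervalIntegral.integral_nonneg hε1 fun x hx =>
      mul_nonneg (sq_nonneg _) (pow_nonneg (hε0.le.trans hx.1) _)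
  have hKB : ε ^ (k + 3 + 1) * ∫ r in ε..1, f'' r ^ 2 ≤
      ∫ r in ε..1, f'' r ^ 2 * r ^ (k + 3 + 1) := by
    rw [← intervalIntegral.integral_const_mul]
    refine intervalIntegral.integral_mono_on hε1 (hg2.const_mul _) iB fun x hx => ?_
    rw [mul_comm]
    exact mul_le_mul_of_nonneg_left (pow_le_pow_left₀ hε0.le hx.1 _) (sq_nonneg _)
  set B2 := ∫ r in ε..1, f'' r ^ 2 * r ^ (k + 3 + 1) with hB2
  set A := √A2 with hA
  have hAA : A ^ 2 = A2 := sq_sqrt hA20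
  have hA0 : 0 ≤ A := sqrt_nonneg _
  set e := ε ^ ((((k + 3 : ℕ) : ℝ) + 1) / 2) with he
  have he0 : 0 < e := rpow_pos_of_pos hε0 _
  have hee : e ^ 2 = ε ^ (k + 3 + 1) := by
    rw [he, ← rpow_natCast, ← rpow_mul hε0.le, ← rpow_natCast ε]
    congr 1; push_cast; ring
  set q := h / e * √B2 with hq
  have hq0 : 0 ≤ q := by positivity
  have hqq : q ^ 2 = h ^ 2 / ε ^ (k + 3 + 1) * B2 := by
    rw [hq, mul_pow, div_pow, hee, sq_sqrt hB20]
  have hEq : E = A * q + q ^ 2 := by rw [hE, hqq, hq]; ring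
  have hKq : h ^ 2 * ∫ r in ε..1, f'' r ^ 2 ≤ q ^ 2 := by
    rw [hqq, div_mul_eq_mul_div, le_div_iff₀ (by positivity)]
    nlinarith [mul_le_mul_of_nonneg_left hKB (sq_nonneg h)]
  -- local estimates
  have hcell : ∀ i : ℕ, m ≤ i → i < N → ∀ x ∈ Ioo ((i : ℝ) / N) (((i + 1 : ℕ) : ℝ) / N),
      ((deriv (interp N f) x - f' x) ^ 2 ≤
        (1 / (N : ℝ)) * ∫ t in ((i : ℝ) / N)..(((i + 1 : ℕ) : ℝ) / N), f'' t ^ 2) ∧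
      ((interp N f x - f x) ^ 2 ≤
        (1 / (N : ℝ)) * ∫ t in ((i : ℝ) / N)..(((i + 1 : ℕ) : ℝ) / N), f'' t ^ 2) ∧
      0 ≤ x ∧ x ≤ 1 := by
    intro i hmi hiN x hx
    have hstep : ((i + 1 : ℕ) : ℝ) / N - (i : ℝ) / N = 1 / N := by push_cast; ring
    have hlo : ε ≤ (i : ℝ) / N := by
      rw [hεm]; exact div_le_div_of_nonneg_right (by exact_mod_cast hmi) hNr.le
    have hhi : ((i + 1 : ℕ) : ℝ) / N ≤ 1 := by
      rw [div_le_one hNr]; exact_mod_cast hiN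
    have hlt : (i : ℝ) / N < ((i + 1 : ℕ) : ℝ) / N := hx.1.trans hx.2
    have hsub : Icc ((i : ℝ) / N) (((i + 1 : ℕ) : ℝ) / N) ⊆ Icc ε 1 := Icc_subset_Icc hlo hhi
    have hsub' : uIcc ((i : ℝ) / N) (((i + 1 : ℕ) : ℝ) / N) ⊆ uIcc ε 1 := by
      rw [hu, uIcc_of_le hlt.le]; exact hsub
    obtain ⟨c1, c2⟩ := cell_est hlt (hfcε.mono hsub)
      (fun y hy => hfd y ⟨hlo.trans_lt hy.1, hy.2.trans_le hhi⟩)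
      (fun y hy z hz => hdiff y (hsub hy) z (hsub hz)) (hg.mono_set hsub') (hg2.mono_set hsub')
    have hK0 : 0 ≤ ∫ t in ((i : ℝ) / N)..(((i + 1 : ℕ) : ℝ) / N), f'' t ^ 2 :=
      intervalIntegral.integral_nonneg hlt.le fun _ _ => sq_nonneg _
    refine ⟨?_, ?_, (hε0.le.trans hlo).trans hx.1.le, hx.2.le.trans hhi⟩
    · rw [deriv_interp_cell hN f i hx]
      exact (c1 x hx).trans_eq (by rw [hstep])
    · rw [interp_cell hN f i (Ioo_subset_Ico_self hx)]
      refine (c2 x hx).trans ?_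
      rw [hstep, ← hh]
      exact mul_le_of_le_one_left (by positivity) (pow_le_one₀ h0.le hh1)
  have measc : ∀ g : ℝ → ℝ, ContinuousOn g (Icc ε 1) →
      AEStronglyMeasurable g (volume.restrict (Ioc ε 1)) := fun g hg =>
    (hg.mono Ioc_subset_Icc_self).aestronglyMeasurable measurableSet_Ioc
  have ms : AEStronglyMeasurable (deriv (interp N f)) (volume.restrict (Ioc ε 1)) :=
    (measurable_deriv _).aestronglyMeasurable
  have mi : AEStronglyMeasurable (interp N f) (volume.restrict (Ioc ε 1)) :=
    (measurable_interp N f).aestronglyMeasurable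
  have gen : ∀ (j : ℕ) (d : ℝ → ℝ), AEStronglyMeasurable d (volume.restrict (Ioc ε 1)) →
      (∀ i : ℕ, m ≤ i → i < N → ∀ x ∈ Ioo ((i : ℝ) / N) (((i + 1 : ℕ) : ℝ) / N),
        d x ^ 2 ≤ (1 / (N : ℝ)) * ∫ t in ((i : ℝ) / N)..(((i + 1 : ℕ) : ℝ) / N), f'' t ^ 2) →
      IntervalIntegrable (fun x => d x ^ 2 * x ^ j) volume ε 1 ∧
        ∫ x in ε..1, d x ^ 2 * x ^ j ≤ q ^ 2 := by
    intro j d hdm hd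
    have := cells_bound hN hmN.le (φ := fun x => d x ^ 2 * x ^ j) (ψ := fun t => f'' t ^ 2)
      (by rw [← hεm]; exact (hdm.pow 2).mul (continuous_pow j).aestronglyMeasurable)
      (by rw [← hεm]; exact hg2)
      (by rw [← hεm]; exact fun x hx =>
            mul_nonneg (sq_nonneg _) (pow_nonneg (hε0.le.trans hx.1.le) _))
      (by
        intro i h1 h2 x hx
        obtain ⟨-, -, hx0, hx1⟩ := hcell i h1 h2 x hx
        exact (mul_le_of_le_one_right (sq_nonneg _) (pow_le_one₀ hx0 hx1)).trans
          (hd i h1 h2 x hx))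
    rw [← hεm, ← hh] at this
    exact ⟨this.1, this.2.trans hKq⟩
  obtain ⟨iD, hD⟩ := gen (k + 2) (fun x => deriv (interp N f) x - f' x) (ms.sub (measc _ hfc'))
    (fun i h1 h2 x hx => (hcell i h1 h2 x hx).1)
  obtain ⟨iG, hG⟩ := gen k (fun x => interp N f x - f x) (mi.sub (measc _ hfcε))
    (fun i h1 h2 x hx => (hcell i h1 h2 x hx).2.1)
  have hG0 : 0 ≤ ∫ x in ε..1, (interp N f x - f x) ^ 2 * x ^ k :=
    intervalIntegral.integral_nonneg hε1 fun x hx =>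
      mul_nonneg (sq_nonneg _) (pow_nonneg (hε0.le.trans hx.1) _)
  have wpos : ∀ j : ℕ, ∀ x ∈ Ioc ε 1, 0 ≤ x ^ j := fun j x hx =>
    pow_nonneg (hε0.le.trans hx.1.le) _
  obtain ⟨iS, hS⟩ := perturb_est hε1 (measc _ hfc') ms (continuous_pow (k + 2)) (wpos _)
    (by apply ContinuousOn.intervalIntegrable; rw [hu]; fun_prop) iD hA0 hq0
    (hAε.trans_eq hAA.symm) hD
  have hardy := hardy_est hε0 hε1 k hfcε hfc' hfd (hf0 ε ⟨hε0.le, le_rfl⟩) hf1 hA0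
    (hAε.trans_eq hAA.symm)
  have iF : IntervalIntegrable (fun x => f x ^ 2 * x ^ k) volume ε 1 := by
    apply ContinuousOn.intervalIntegrable; rw [hu]; fun_prop
  obtain ⟨iP, hP⟩ := perturb_est hε1 (measc _ hfcε) mi (continuous_pow k) (wpos _)
    iF iG (by positivity : 0 ≤ 2 * A) hq0 hardy hG
  -- the part on `[0, ε]`
  have split : ∀ φ : ℝ → ℝ, (∀ x ∈ Ioo 0 ε, φ x = 0) → IntervalIntegrable φ volume ε 1 →
      ∫ x in (0:ℝ)..1, φ x = ∫ x in ε..1, φ x := by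
    intro φ hz hi
    have hz' : EqOn (fun _ : ℝ => (0 : ℝ)) φ (Ioo 0 ε) := fun x hx => (hz x hx).symm
    have i0 : IntervalIntegrable φ volume 0 ε := by
      refine IntervalIntegrable.congr_uIoo (f := fun _ => (0 : ℝ)) intervalIntegrable_const ?_
      rw [uIoo_of_le hε0.le]; exact hz'
    rw [← intervalIntegral.integral_add_adjacent_intervals i0 hi,
      ← intervalIntegral.integral_congr_Ioo_of_le hε0.le hz']
    simp
  have hiz : ∀ x ∈ Ioo 0 ε, interp N f x = 0 := fun x hx =>
    interp_zero hN (by rw [← hεm]; exact hf0) (by rw [← hεm]; exact Ioo_subset_Ico_self hx)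
  have hdz : ∀ x ∈ Ioo 0 ε, deriv (interp N f) x = 0 := by
    intro x hx
    have : interp N f =ᶠ[nhds x] fun _ => (0 : ℝ) := by
      filter_upwards [Ioo_mem_nhds hx.1 hx.2] with y hy using hiz y hy
    rw [this.deriv_eq]; simp
  rw [split (fun r => deriv (interp N f) r ^ 2 * r ^ (k + 2))
      (fun x hx => by simp [hdz x hx]) iS,
    split (fun r => interp N f r ^ 2 * r ^ k) (fun x hx => by simp [hiz x hx]) iP,
    split (fun r => f r ^ 2 * r ^ k)
      (fun x hx => by simp [hf0 x ⟨hx.1.le, hx.2.le⟩]) iF]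
  have hS' := (abs_le.1 hS).2
  have hP' := (abs_le.1 hP).1
  have hAq : 0 ≤ A * q := by positivity
  have hq2 : 0 ≤ q ^ 2 := sq_nonneg q
  rw [hEq]
  constructor <;> linarith
end
end

section
/- Fix an integer n ≥ 3. For every η > 0 there exists N₀ such that for every integer N ≥ N₀, setting h = 1/N, one has S^n_h ≤ (n−2)²/4 + (n+1)²·π²/( 2|log h| − 6·log|log h| )² + η/(log h)². -/
open MeasureTheory Real Set Filter

noncomputable section

/-- Membership in the finite element space `V_h` with `h = 1/N`: continuous on `[0,1]`
and affine on each mesh interval `[k/N, (k+1)/N]`. -/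
def MemVh (N : ℕ) (v : ℝ → ℝ) : Prop :=
  ContinuousOn v (Set.Icc 0 1) ∧
  ∀ k : ℕ, k < N → ∃ a b : ℝ,
    ∀ x ∈ Set.Icc ((k : ℝ) / (N : ℝ)) (((k : ℝ) + 1) / (N : ℝ)), v x = a * x + b

/-- The discrete Hardy constant `S^n_h` in dimension `n ≥ 3`, for `h = 1/N`. -/
def SdiscN (n N : ℕ) : ℝ :=
  sInf { s : ℝ | ∃ v : ℝ → ℝ, MemVh N v ∧ v 1 = 0 ∧ (∃ x ∈ Set.Icc (0:ℝ) 1, v x ≠ 0) ∧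
    s = (∫ r in (0:ℝ)..1, r ^ (n - 1) * (deriv v r) ^ 2)
        / (∫ r in (0:ℝ)..1, r ^ (n - 3) * (v r) ^ 2) }

lemma cs_aux (u u' : ℝ → ℝ) (s t : ℝ) (hst : s ≤ t)
    (hu : ∀ x ∈ Set.Icc s t, HasDerivAt u (u' x) x) (hc : ContinuousOn u' (Set.Icc s t)) :
    (u t - u s) ^ 2 ≤ (t - s) * ∫ r in s..t, u' r ^ 2 := by
  rcases hst.eq_or_lt with rfl | hlt
  · simp
  have hI : IntervalIntegrable u' volume s t := (by rwa [uIcc_of_le hst] : ContinuousOn u' (uIcc s t)).intervalIntegrable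
  have hI2 : IntervalIntegrable (fun r => u' r ^ 2) volume s t :=
    (by rw [uIcc_of_le hst]; exact hc.pow 2 : ContinuousOn (fun r => u' r ^ 2) (uIcc s t)).intervalIntegrable
  have h1 : ∫ r in s..t, u' r = u t - u s :=
    intervalIntegral.integral_eq_sub_of_hasDerivAt (by rwa [uIcc_of_le hst]) hI
  set c := (u t - u s) / (t - s) with hcdef
  have h2 : 0 ≤ ∫ r in s..t, (u' r - c) ^ 2 :=
    intervalIntegral.integral_nonneg hst (fun x _ => sq_nonneg _)
  have h3 : ∫ r in s..t, (u' r - c) ^ 2 = (∫ r in s..t, u' r ^ 2) - 2 * c * (u t - u s) + (t - s) * c ^ 2 := by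
    have : ∀ r, (u' r - c) ^ 2 = (u' r ^ 2 - 2 * c * u' r) + c ^ 2 := fun r => by ring
    simp_rw [this]
    rw [intervalIntegral.integral_add (hI2.sub (hI.const_mul _)) (by simp),
      intervalIntegral.integral_sub hI2 (hI.const_mul _), intervalIntegral.integral_const_mul, h1]
    simp
  have hd : 0 < t - s := by linarith
  have h4 : c * (t - s) = u t - u s := by rw [hcdef]; field_simp
  rw [h3] at h2
  have h5 := mul_nonneg hd.le h2
  have : (t - s) * ((∫ r in s..t, u' r ^ 2) - 2 * c * (u t - u s) + (t - s) * c ^ 2)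
    = (t - s) * (∫ r in s..t, u' r ^ 2) - (u t - u s) ^ 2 := by
    rw [← h4]; ring
  linarith

lemma cs_aux2 (u u' : ℝ → ℝ) (s t : ℝ) 
    (hu : ∀ x ∈ Set.Icc s t, HasDerivAt u (u' x) x) (hc : ContinuousOn u' (Set.Icc s t))
    (x y : ℝ) (hsx : s ≤ x) (hxy : x ≤ y) (hyt : y ≤ t) :
    (u y - u x) ^ 2 ≤ (t - s) * ∫ r in s..t, u' r ^ 2 := by
  have hst : s ≤ t := by linarith
  have hss : Icc x y ⊆ Icc s t := Icc_subset_Icc hsx hyt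
  have h1 := cs_aux u u' x y hxy (fun z hz => hu z (hss hz)) (hc.mono hss)
  have hI2 : IntervalIntegrable (fun r => u' r ^ 2) volume s t :=
    (by rw [uIcc_of_le hst]; exact hc.pow 2 : ContinuousOn (fun r => u' r ^ 2) (uIcc s t)).intervalIntegrable
  have h2 : ∫ r in x..y, u' r ^ 2 ≤ ∫ r in s..t, u' r ^ 2 := 
    intervalIntegral.integral_mono_interval hsx hxy hyt (ae_of_all _ fun z => sq_nonneg _) hI2
  have h3 : 0 ≤ ∫ r in x..y, u' r ^ 2 := 
    intervalIntegral.integral_nonneg hxy (fun x _ => sq_nonneg _)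
  refine h1.trans (mul_le_mul (by linarith) h2 h3 (by linarith))

lemma cs_interp (u u' : ℝ → ℝ) (s t : ℝ) 
    (hu : ∀ x ∈ Set.Icc s t, HasDerivAt u (u' x) x) (hc : ContinuousOn u' (Set.Icc s t))
    (x θ : ℝ) (hsx : s ≤ x) (hxt : x ≤ t) (h0 : 0 ≤ θ) (h1 : θ ≤ 1) :
    (u x - (u s + (u t - u s) * θ)) ^ 2 ≤ (t - s) * ∫ r in s..t, u' r ^ 2 := by
  have a := cs_aux2 u u' s t hu hc s x le_rfl hsx hxt
  have b := cs_aux2 u u' s t hu hc x t hsx hxt le_rfl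
  set E := (t - s) * ∫ r in s..t, u' r ^ 2
  have : (u x - (u s + (u t - u s) * θ)) ^ 2 = (1 - θ) * (u x - u s) ^ 2 + θ * (u t - u x) ^ 2
     - θ * (1 - θ) * (u t - u s) ^ 2 := by ring
  have h3 : 0 ≤ θ * (1 - θ) * (u t - u s) ^ 2 := by
    have : 0 ≤ 1 - θ := by linarith
    positivity
  nlinarith [mul_le_mul_of_nonneg_left a (sub_nonneg.2 h1), mul_le_mul_of_nonneg_left b h0]

def plf (N : ℕ) (c : ℕ → ℝ) (x : ℝ) : ℝ :=
  c 0 + ∑ k ∈ Finset.range N, (c (k+1) - c k) * max 0 (min 1 (N * x - k))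

lemma plf_cont (N : ℕ) (c : ℕ → ℝ) : Continuous (plf N c) := by
  unfold plf; fun_prop

lemma plf_eq (N : ℕ) (c : ℕ → ℝ) (j : ℕ) (hj : j < N) (x : ℝ)
    (hx : x ∈ Set.Icc ((j : ℝ) / (N : ℝ)) (((j : ℝ) + 1) / (N : ℝ))) :
    plf N c x = c j + (c (j+1) - c j) * (N * x - j) := by
  have hN : (0:ℝ) < N := by exact_mod_cast (by omega : 0 < N)
  have h1 : (j : ℝ) ≤ N * x := by have := hx.1; rw [div_le_iff₀ hN] at this; linarith
  have h2 : N * x ≤ j + 1 := by have := hx.2; rw [le_div_iff₀ hN] at this; linarith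
  have A : ∀ M ≤ j, c 0 + ∑ k ∈ Finset.range M, (c (k+1) - c k) * max 0 (min 1 (N * x - k)) = c M := by
    intro M
    induction M with
    | zero => simp
    | succ M ih =>
      intro hM
      rw [Finset.sum_range_succ, ← add_assoc, ih (by omega)]
      have : (M : ℝ) + 1 ≤ j := by exact_mod_cast hM
      rw [min_eq_left (by linarith), max_eq_right (by norm_num)]; ring
  have B : ∀ M, j + 1 ≤ M → c 0 + ∑ k ∈ Finset.range M, (c (k+1) - c k) * max 0 (min 1 (N * x - k)) 
      = c j + (c (j+1) - c j) * (N * x - j) := by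
    intro M hM
    induction M, hM using Nat.le_induction with
    | base =>
      rw [Finset.sum_range_succ, ← add_assoc, A j le_rfl, min_eq_right (by linarith), max_eq_right (by linarith)]
    | succ M hM ih =>
      rw [Finset.sum_range_succ, ← add_assoc, ih]
      have : (j : ℝ) + 1 ≤ M := by exact_mod_cast hM
      rw [max_eq_left (min_le_of_right_le (by linarith))]; ring
  exact B N hj

lemma plf_deriv (N : ℕ) (c : ℕ → ℝ) (j : ℕ) (hj : j < N) (x : ℝ)
    (hx : x ∈ Set.Ioo ((j : ℝ) / (N : ℝ)) (((j : ℝ) + 1) / (N : ℝ))) :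
    deriv (plf N c) x = (c (j+1) - c j) * N := by
  have : plf N c =ᶠ[nhds x] fun x => c j + (c (j+1) - c j) * (N * x - j) := by
    filter_upwards [Ioo_mem_nhds hx.1 hx.2] with y hy using plf_eq N c j hj y (Ioo_subset_Icc_self hy)
  rw [this.deriv_eq]
  have h : HasDerivAt (fun x : ℝ => c j + (c (j+1) - c j) * (N * x - j)) ((c (j+1) - c j) * (N * 1)) x :=
    ((((hasDerivAt_id x).const_mul (N:ℝ)).sub_const (j:ℝ)).const_mul _).const_add _
  simpa using h.deriv

lemma piece_a (u' : ℝ → ℝ) (m K : ℕ) (hK : 0 < K) (s t : ℝ) (hs : 0 < s) (hst : s ≤ t)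
    (hts : t ≤ (1 + 1 / (K:ℝ)) * s) (hc : ContinuousOn u' (Set.Icc s t)) :
    t ^ (m + 2) * ∫ r in s..t, u' r ^ 2
      ≤ (1 + 1 / (K:ℝ)) ^ (m + 2) * ∫ r in s..t, r ^ (m + 2) * u' r ^ 2 := by
  rw [← intervalIntegral.integral_const_mul, ← intervalIntegral.integral_const_mul]
  have hKr : (0:ℝ) < K := by exact_mod_cast hK
  have e := uIcc_of_le hst
  apply intervalIntegral.integral_mono_on hst
  · apply ContinuousOn.intervalIntegrable; rw [e]; fun_prop
  · apply ContinuousOn.intervalIntegrable; rw [e]; fun_prop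
  · intro x hx
    rw [← mul_assoc, ← mul_pow]
    have h1 : t ≤ (1 + 1 / (K:ℝ)) * x := hts.trans (by gcongr; exact hx.1)
    have h0 : 0 ≤ t := by linarith
    gcongr

lemma int_pow_le (p : ℕ) (s t : ℝ) (hs : 0 < s) (hst : s ≤ t) :
    ∫ r in s..t, r ^ p ≤ (t - s) * t ^ p := by
  have : ∫ r in s..t, r ^ p ≤ ∫ r in s..t, t ^ p := by
    apply intervalIntegral.integral_mono_on hst
    · apply Continuous.intervalIntegrable; fun_prop
    · simp
    · intro x hx
      have := hx.1
      have h0 : 0 ≤ x := by linarith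
      exact pow_le_pow_left₀ h0 hx.2 p
  simpa using this

lemma piece_b (u u' : ℝ → ℝ) (m K : ℕ) (hK : 0 < K) (s t d M : ℝ) (hs : 0 < s) (hst : s ≤ t)
    (hts : t ≤ (1 + 1 / (K:ℝ)) * s) 
    (hu : ∀ x ∈ Set.Icc s t, HasDerivAt u (u' x) x) (hc : ContinuousOn u' (Set.Icc s t))
    (hM : M * (t - s) = 1) (hd : d = (u t - u s) * M) :
    ∫ r in s..t, r ^ (m + 2) * d ^ 2
      ≤ (1 + 1 / (K:ℝ)) ^ (m + 2) * ∫ r in s..t, r ^ (m + 2) * u' r ^ 2 := by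
  refine le_trans ?_ (piece_a u' m K hK s t hs hst hts hc)
  rw [intervalIntegral.integral_mul_const]
  have h1 := int_pow_le (m+2) s t hs hst
  have h2 := cs_aux u u' s t hst hu hc
  have ht : 0 ≤ t := by linarith
  calc (∫ r in s..t, r ^ (m+2)) * d ^ 2 ≤ ((t - s) * t ^ (m+2)) * d ^ 2 := by gcongr
    _ = (t - s) * t ^ (m+2) * M ^ 2 * (u t - u s) ^ 2 := by rw [hd]; ring
    _ ≤ (t - s) * t ^ (m+2) * M ^ 2 * ((t - s) * ∫ r in s..t, u' r ^ 2) := by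
        have : 0 ≤ t - s := by linarith
        gcongr
    _ = (M * (t - s)) ^ 2 * (t ^ (m+2) * ∫ r in s..t, u' r ^ 2) := by ring
    _ = _ := by rw [hM]; ring

lemma piece_c (u u' v : ℝ → ℝ) (m K : ℕ) (hK : 0 < K) (s t M : ℝ) (hs : 0 < s) (hst : s ≤ t)
    (hts : t ≤ (1 + 1 / (K:ℝ)) * s) (hKt : (t - s) * K ≤ t)
    (hu : ∀ x ∈ Set.Icc s t, HasDerivAt u (u' x) x) (hc : ContinuousOn u' (Set.Icc s t))
    (hM : M * (t - s) = 1) (hvc : Continuous v)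
    (hv : ∀ x ∈ Set.Icc s t, v x = u s + (u t - u s) * (M * (x - s))) :
    ∫ r in s..t, r ^ m * u r ^ 2
      ≤ (1 + 1 / (K:ℝ)) * (∫ r in s..t, r ^ m * v r ^ 2) 
      + (2 / K) * ((1 + 1 / (K:ℝ)) ^ (m + 2) * ∫ r in s..t, r ^ (m + 2) * u' r ^ 2) := by
  have hKr : (1:ℝ) ≤ K := by exact_mod_cast hK
  have huc : ContinuousOn u (Icc s t) := HasDerivAt.continuousOn hu
  have e := uIcc_of_le hst
  have hM0 : 0 ≤ M := by
    by_contra h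
    push Not at h
    nlinarith
  have ht : 0 ≤ t := by linarith
  have hts0 : 0 ≤ t - s := by linarith
  set J := ∫ r in s..t, u' r ^ 2 with hJ
  have hJ0 : 0 ≤ J := intervalIntegral.integral_nonneg hst (fun x _ => sq_nonneg _)
  have hA := piece_a u' m K hK s t hs hst hts hc
  have key : ∫ r in s..t, r ^ m * u r ^ 2 ≤ ∫ r in s..t, ((1 + 1 / (K:ℝ)) * (r ^ m * v r ^ 2) + (1 + K) * ((t - s) * J) * r ^ m) := by
    apply intervalIntegral.integral_mono_on hst
    · apply ContinuousOn.intervalIntegrable; rw [e]; fun_prop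
    · apply Continuous.intervalIntegrable; fun_prop
    · intro x hx
      have hx1 := hx.1
      have hx2 := hx.2
      have hb := cs_interp u u' s t hu hc x (M * (x - s)) hx.1 hx.2 
        (mul_nonneg hM0 (by linarith)) (by rw [← hM]; gcongr)
      rw [← hv x hx] at hb
      have hx0 : 0 ≤ x := by linarith
      have h3 : u x ^ 2 ≤ (1 + 1 / (K:ℝ)) * v x ^ 2 + (1 + K) * (u x - v x) ^ 2 := by
        have : (1 + 1 / (K:ℝ)) * v x ^ 2 + (1 + K) * (u x - v x) ^ 2 - u x ^ 2
          = (v x - K * (u x - v x)) ^ 2 / K := by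
          field_simp; ring
        have h4 : 0 ≤ (v x - K * (u x - v x)) ^ 2 / K := by positivity
        linarith
      calc x ^ m * u x ^ 2 ≤ x ^ m * ((1 + 1 / (K:ℝ)) * v x ^ 2 + (1 + K) * ((t - s) * J)) := by
            gcongr
            refine h3.trans ?_
            gcongr
        _ = _ := by ring
  rw [intervalIntegral.integral_add (by apply Continuous.intervalIntegrable; fun_prop) (by apply Continuous.intervalIntegrable; fun_prop),
    intervalIntegral.integral_const_mul, intervalIntegral.integral_const_mul] at key
  refine key.trans (add_le_add le_rfl ?_)
  calc (1 + K) * ((t - s) * J) * ∫ r in s..t, r ^ m ≤ (1 + K) * ((t - s) * J) * ((t - s) * t ^ m) := by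
        gcongr; exact int_pow_le m s t hs hst
    _ = ((1 + K) / K ^ 2) * ((t - s) * K) ^ 2 * t ^ m * J := by field_simp
    _ ≤ (2 / K) * t ^ 2 * t ^ m * J := by
        have : ((1 + K) / K ^ 2 : ℝ) ≤ 2 / K := by
          rw [div_le_div_iff₀ (by positivity) (by positivity)]; nlinarith
        gcongr
    _ = (2 / K) * (t ^ (m+2) * J) := by ring
    _ ≤ _ := by gcongr

lemma interp_main (u u' : ℝ → ℝ) (m N K : ℕ) (hK : 0 < K) (hKN : K < N)
    (hu : ∀ x > 0, HasDerivAt u (u' x) x) (hc : ContinuousOn u' (Set.Ioi 0))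
    (h0 : u ((K:ℝ) / N) = 0) (h1 : u 1 = 0) :
    ∃ v : ℝ → ℝ, MemVh N v ∧ v 1 = 0 ∧
      (∫ r in (0:ℝ)..1, r ^ (m + 2) * (deriv v r) ^ 2) ≤
        (1 + 1 / (K:ℝ)) ^ (m + 2) * (∫ r in ((K:ℝ)/N)..1, r ^ (m + 2) * u' r ^ 2) ∧
      (∫ r in ((K:ℝ)/N)..1, r ^ m * u r ^ 2) ≤ 
        (1 + 1 / (K:ℝ)) * (∫ r in (0:ℝ)..1, r ^ m * v r ^ 2) 
        + (2 / K) * ((1 + 1 / (K:ℝ)) ^ (m + 2) * (∫ r in ((K:ℝ)/N)..1, r ^ (m + 2) * u' r ^ 2)) := by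
  have hN : (0:ℝ) < N := by exact_mod_cast (by omega : 0 < N)
  have hKr : (0:ℝ) < K := by exact_mod_cast hK
  set c : ℕ → ℝ := fun k => if k ≤ K then 0 else u (k / N) with hcdef
  have hcu : ∀ k, K ≤ k → c k = u (k / N) := by
    intro k hk
    rcases hk.eq_or_lt with rfl | h
    · simp [hcdef, h0]
    · simp [hcdef, h]
  have hc0 : ∀ k, k ≤ K → c k = 0 := by intro k hk; simp [hcdef, hk]
  set a : ℕ → ℝ := fun k => (k:ℝ) / N with ha
  have ha0 : a 0 = 0 := by simp [ha]
  have haN : a N = 1 := by simp only [ha]; exact div_self hN.ne'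
  have has : ∀ k, a (k+1) = ((k:ℝ) + 1) / N := by intro k; simp [ha]
  have hale : ∀ k, a k ≤ a (k+1) := by intro k; rw [has]; simp only [ha]; gcongr; linarith
  have hM : ∀ k, (N:ℝ) * (a (k+1) - a k) = 1 := by intro k; rw [has]; simp only [ha]; field_simp; ring
  have hpos : ∀ k, K ≤ k → 0 < a k := by
    intro k hk
    have : (0:ℝ) < k := by exact_mod_cast (by omega : 0 < k)
    simp only [ha]; positivity
  have hts : ∀ k, K ≤ k → a (k+1) ≤ (1 + 1 / (K:ℝ)) * a k := by
    intro k hk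
    have : (K:ℝ) ≤ k := by exact_mod_cast hk
    rw [has]; simp only [ha]
    rw [← mul_div_assoc]
    gcongr
    have : 1 ≤ 1 / (K:ℝ) * k := by rw [one_div, inv_mul_eq_div, le_div_iff₀ hKr]; linarith
    linarith
  have hKt : ∀ k, K ≤ k → (a (k+1) - a k) * K ≤ a (k+1) := by
    intro k hk
    have : (K:ℝ) ≤ k := by exact_mod_cast hk
    rw [has]; simp only [ha]
    rw [← sub_div, div_mul_eq_mul_div]
    gcongr
    linarith
  have hu' : ∀ k, K ≤ k → ∀ x ∈ Icc (a k) (a (k+1)), HasDerivAt u (u' x) x := by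
    intro k hk x hx
    exact hu x (lt_of_lt_of_le (hpos k hk) hx.1)
  have hc' : ∀ k, K ≤ k → ContinuousOn u' (Icc (a k) (a (k+1))) := by
    intro k hk
    exact hc.mono fun x hx => lt_of_lt_of_le (hpos k hk) hx.1
  have huc : ∀ k, K ≤ k → ContinuousOn u (Icc (a k) (a (k+1))) := fun k hk => HasDerivAt.continuousOn (hu' k hk)
  have hvc := plf_cont N c
  have hveq : ∀ k < N, ∀ x ∈ Icc (a k) (a (k+1)), plf N c x = c k + (c (k+1) - c k) * (N * (x - a k)) := by
    intro k hk x hx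
    rw [plf_eq N c k hk x (by rw [← has]; exact hx)]
    simp only [ha]; field_simp
  have hder : ∀ k < N, EqOn (fun r => r ^ (m+2) * ((c (k+1) - c k) * N) ^ 2) (fun r => r ^ (m + 2) * (deriv (plf N c) r) ^ 2) (uIoo (a k) (a (k+1))) := by
    intro k hk x hx
    rw [uIoo_of_le (hale k)] at hx
    simp only
    rw [plf_deriv N c k hk x (by rw [← has]; exact hx)]
  refine ⟨plf N c, ⟨hvc.continuousOn, ?_⟩, ?_, ?_, ?_⟩
  · intro k hk
    refine ⟨(c (k+1) - c k) * N, c k - (c (k+1) - c k) * k, fun x hx => ?_⟩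
    rw [plf_eq N c k hk x hx]; ring
  · obtain ⟨j, rfl⟩ : ∃ j, N = j + 1 := ⟨N - 1, by omega⟩
    rw [hveq j (by omega) 1 ⟨by rw [← haN]; exact hale j, haN.ge⟩, ← haN, hM, hcu (j+1) (by omega)]
    have : ((j + 1 : ℕ) : ℝ) / ((j+1 : ℕ):ℝ) = 1 := by field_simp
    rw [this, h1]; ring
  · have hI : ∀ k < N, IntervalIntegrable (fun r => r ^ (m + 2) * (deriv (plf N c) r) ^ 2) volume (a k) (a (k+1)) := by
      intro k hk
      refine IntervalIntegrable.congr_uIoo ?_ (hder k hk)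
      apply Continuous.intervalIntegrable; fun_prop
    have hsum := intervalIntegral.sum_integral_adjacent_intervals hI
    have hsum2 := intervalIntegral.sum_integral_adjacent_intervals_Ico (f := fun r => r ^ (m + 2) * u' r ^ 2) (μ := volume) (a := a) hKN.le (by
      intro k hk
      apply ContinuousOn.intervalIntegrable
      rw [uIcc_of_le (hale k)]
      have := hc' k hk.1
      fun_prop)
    rw [ha0, haN] at hsum
    rw [haN] at hsum2
    change _ ≤ _ * ∫ r in (a K)..1, _
    rw [← hsum, ← hsum2, Finset.mul_sum, ← Finset.sum_range_add_sum_Ico _ hKN.le]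
    have hz : ∑ k ∈ Finset.range K, ∫ r in (a k)..(a (k+1)), r ^ (m + 2) * (deriv (plf N c) r) ^ 2 = 0 := by
      apply Finset.sum_eq_zero
      intro k hk
      have hk := Finset.mem_range.1 hk
      rw [← intervalIntegral.integral_congr_uIoo (hder k (by omega)), hc0 k (by omega), hc0 (k+1) (by omega)]
      simp
    rw [hz, zero_add]
    apply Finset.sum_le_sum
    intro k hk
    have hk := Finset.mem_Ico.1 hk
    rw [← intervalIntegral.integral_congr_uIoo (hder k hk.2)]
    exact piece_b u u' m K hK _ _ _ N (hpos k hk.1) (hale k) (hts k hk.1) (hu' k hk.1) (hc' k hk.1) (hM k)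
      (by rw [hcu k hk.1, hcu (k+1) (by omega)])
  · have hsum := intervalIntegral.sum_integral_adjacent_intervals (f := fun r => r ^ m * (plf N c r) ^ 2) (μ := volume) (a := a) (n := N) (by
      intro k hk
      apply Continuous.intervalIntegrable; fun_prop)
    have hsum2 := intervalIntegral.sum_integral_adjacent_intervals_Ico (f := fun r => r ^ (m + 2) * u' r ^ 2) (μ := volume) (a := a) hKN.le (by
      intro k hk
      apply ContinuousOn.intervalIntegrable
      rw [uIcc_of_le (hale k)]
      have := hc' k hk.1
      fun_prop)
    have hsum3 := intervalIntegral.sum_integral_adjacent_intervals_Ico (f := fun r => r ^ m * u r ^ 2) (μ := volume) (a := a) hKN.le (by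
      intro k hk
      apply ContinuousOn.intervalIntegrable
      rw [uIcc_of_le (hale k)]
      have := huc k hk.1
      fun_prop)
    rw [ha0, haN] at hsum
    rw [haN] at hsum2 hsum3
    change ∫ r in (a K)..1, _ ≤ _ + _ * (_ * ∫ r in (a K)..1, _)
    have hz : 0 ≤ ∑ k ∈ Finset.range K, ∫ r in (a k)..(a (k+1)), r ^ m * (plf N c r) ^ 2 := by
      apply Finset.sum_nonneg
      intro k hk
      apply intervalIntegral.integral_nonneg (hale k)
      intro x hx
      have : 0 ≤ a k := by simp only [ha]; positivity
      have : 0 ≤ x := this.trans hx.1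
      positivity
    rw [← hsum, ← hsum2, ← hsum3, ← Finset.sum_range_add_sum_Ico _ hKN.le]
    have hmain : ∑ k ∈ Finset.Ico K N, ∫ r in (a k)..(a (k+1)), r ^ m * u r ^ 2 ≤
      (1 + 1 / (K:ℝ)) * (∑ k ∈ Finset.Ico K N, ∫ r in (a k)..(a (k+1)), r ^ m * (plf N c r) ^ 2) 
      + (2 / K) * ((1 + 1 / (K:ℝ)) ^ (m + 2) * ∑ k ∈ Finset.Ico K N, ∫ r in (a k)..(a (k+1)), r ^ (m + 2) * u' r ^ 2) := by
      rw [Finset.mul_sum, Finset.mul_sum, Finset.mul_sum, ← Finset.sum_add_distrib]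
      apply Finset.sum_le_sum
      intro k hk
      have hk := Finset.mem_Ico.1 hk
      refine piece_c u u' (plf N c) m K hK _ _ N (hpos k hk.1) (hale k) (hts k hk.1) (hKt k hk.1) (hu' k hk.1) (hc' k hk.1) (hM k) hvc ?_
      intro x hx
      rw [hveq k hk.2 x hx, hcu k hk.1, hcu (k+1) (by omega)]
    refine hmain.trans (add_le_add ?_ le_rfl)
    gcongr
    linarith

lemma exp_id (m : ℕ) (x : ℝ) (hx : 0 < x) :
    Real.exp ((((m:ℝ) + 1) / 2) * (-Real.log x)) ^ 2 = (x ^ (m + 1))⁻¹ := by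
  have h : x ^ (m+1) = Real.exp (((m+1 : ℕ) : ℝ) * Real.log x) := by
    rw [Real.exp_nat_mul, Real.exp_log hx]
  rw [h, ← Real.exp_neg, sq, ← Real.exp_add]
  congr 1
  push_cast; ring

lemma int_poly_log (g G : ℝ → ℝ) (hG : ∀ t, HasDerivAt G (g t) t) (hg : Continuous g) (a : ℝ) (ha : 0 < a)
    (ha1 : a ≤ 1) : ∫ r in a..1, r⁻¹ * g (-Real.log r) = G (-Real.log a) - G 0 := by
  have e := uIcc_of_le ha1
  have hne : ∀ x ∈ Icc a 1, x ≠ 0 := fun x hx => (lt_of_lt_of_le ha hx.1).ne'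
  have : ∫ r in a..1, r⁻¹ * g (-Real.log r) = (fun r => - G (-Real.log r)) 1 - (fun r => - G (-Real.log r)) a := by
    refine intervalIntegral.integral_eq_sub_of_hasDerivAt (f := fun r => - G (-Real.log r)) ?_ ?_
    · intro x hx
      rw [e] at hx
      have h1 := (Real.hasDerivAt_log (hne x hx)).neg
      have h2 := ((hG (-Real.log x)).comp x h1).neg
      exact h2.congr_deriv (by ring)
    · apply ContinuousOn.intervalIntegrable
      rw [e]
      have h1 : ContinuousOn Real.log (Icc a 1) := Real.continuousOn_log.mono (fun x hx => hne x hx)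
      have h2 : ContinuousOn (fun x : ℝ => x⁻¹) (Icc a 1) := continuousOn_inv₀.mono (fun x hx => hne x hx)
      exact h2.mul (hg.comp_continuousOn h1.neg)
  rw [this]; simp; ring

def uu (m : ℕ) (l : ℝ) (x : ℝ) : ℝ :=
  Real.exp ((((m:ℝ) + 1) / 2) * (-Real.log x)) * ((-Real.log x) * (l - (-Real.log x)))

def uu' (m : ℕ) (l : ℝ) (x : ℝ) : ℝ :=
  - x⁻¹ * (Real.exp ((((m:ℝ) + 1) / 2) * (-Real.log x)) * ((((m:ℝ) + 1) / 2) * ((-Real.log x) * (l - (-Real.log x)))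
    + (l - 2 * (-Real.log x))))

lemma uu_deriv (m : ℕ) (l x : ℝ) (hx : 0 < x) : HasDerivAt (uu m l) (uu' m l x) x := by
  have h1 : HasDerivAt (fun x => -Real.log x) (-x⁻¹) x := (Real.hasDerivAt_log hx.ne').neg
  have h2 := ((h1.const_mul (((m:ℝ) + 1) / 2)).exp).mul (h1.mul (h1.const_sub l))
  refine h2.congr_deriv ?_
  unfold uu'; simp only [Pi.mul_apply]; ring

lemma uu'_cont (m : ℕ) (l : ℝ) : ContinuousOn (uu' m l) (Ioi 0) := by
  have hne : ∀ x ∈ Ioi (0:ℝ), x ≠ 0 := fun x hx => (ne_of_gt hx)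
  have h1 : ContinuousOn Real.log (Ioi 0) := Real.continuousOn_log.mono (fun x hx => hne x hx)
  have h2 : ContinuousOn (fun x : ℝ => x⁻¹) (Ioi 0) := continuousOn_inv₀.mono (fun x hx => hne x hx)
  unfold uu'
  fun_prop

lemma uu_B (m : ℕ) (a : ℝ) (ha : 0 < a) (ha1 : a ≤ 1) :
    ∫ r in a..1, r ^ m * uu m (-Real.log a) r ^ 2 = (-Real.log a) ^ 5 / 30 := by
  set l := -Real.log a with hl
  have h := int_poly_log (fun t => (t * (l - t)) ^ 2) (fun t => l ^ 2 * t ^ 3 / 3 - l * t ^ 4 / 2 + t ^ 5 / 5)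
    (by
      intro t
      have h3 := ((hasDerivAt_pow 3 t).const_mul (l^2)).div_const 3
      have h4 := ((hasDerivAt_pow 4 t).const_mul l).div_const 2
      have h5 := (hasDerivAt_pow 5 t).div_const 5
      refine ((h3.sub h4).add h5).congr_deriv ?_
      norm_num; ring) (by fun_prop) a ha ha1
  rw [← hl] at h
  rw [show l ^ 5 / 30 = (l ^ 2 * l ^ 3 / 3 - l * l ^ 4 / 2 + l ^ 5 / 5) - (l ^ 2 * 0 ^ 3 / 3 - l * 0 ^ 4 / 2 + 0 ^ 5 / 5) by ring]
  rw [← h]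
  apply intervalIntegral.integral_congr
  intro x hx
  rw [uIcc_of_le ha1] at hx
  have hx0 : 0 < x := lt_of_lt_of_le ha hx.1
  simp only [uu]
  rw [mul_pow, exp_id m x hx0]
  field_simp
  ring

lemma uu_A (m : ℕ) (a : ℝ) (ha : 0 < a) (ha1 : a ≤ 1) :
    ∫ r in a..1, r ^ (m + 2) * uu' m (-Real.log a) r ^ 2 = 
      (((m:ℝ) + 1) / 2) ^ 2 * ((-Real.log a) ^ 5 / 30) + (-Real.log a) ^ 3 / 3 := by
  set l := -Real.log a with hl
  set α := ((m:ℝ) + 1) / 2 with hα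
  have h := int_poly_log (fun t => (α * (t * (l - t)) + (l - 2 * t)) ^ 2) 
    (fun t => α ^ 2 * (l ^ 2 * t ^ 3 / 3 - l * t ^ 4 / 2 + t ^ 5 / 5) + α * (l ^ 2 * t ^ 2 - 2 * l * t ^ 3 + t ^ 4)
      + (l ^ 2 * t - 2 * l * t ^ 2 + 4 * t ^ 3 / 3))
    (by
      intro t
      have h1 := hasDerivAt_id t
      have h2 := hasDerivAt_pow 2 t
      have h3 := hasDerivAt_pow 3 t
      have h4 := hasDerivAt_pow 4 t
      have h5 := hasDerivAt_pow 5 t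
      have k1 := ((((h3.const_mul (l^2)).div_const 3).sub ((h4.const_mul l).div_const 2)).add (h5.div_const 5)).const_mul (α^2)
      have k2 := (((h2.const_mul (l^2)).sub (h3.const_mul (2*l))).add h4).const_mul α
      have k3 := ((h1.const_mul (l^2)).sub (h2.const_mul (2*l))).add ((h3.const_mul 4).div_const 3)
      refine ((k1.add k2).add k3).congr_deriv ?_
      norm_num; ring) (by fun_prop) a ha ha1
  rw [← hl] at h
  refine Eq.trans ?_ (h.trans (by ring))
  apply intervalIntegral.integral_congr
  intro x hx
  rw [uIcc_of_le ha1] at hx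
  have hx0 : 0 < x := lt_of_lt_of_le ha hx.1
  simp only [uu']
  rw [mul_pow, mul_pow, exp_id m x hx0, hα]
  field_simp
  ring

lemma fin_aux (B lam Lam x q C Num Den : ℝ) (hB : 0 < B) (hl : 0 ≤ lam) (hlL : lam ≤ Lam)
    (hx : 0 < x) (hx1 : x ≤ 1) (hC : 0 ≤ C) (hq0 : 0 ≤ q) (hq : q ≤ 1 + C * x)
    (hNum : Num ≤ q * (lam * B)) (hDen : B ≤ (1 + x) * Den + 2 * x * (q * (lam * B)))
    (hsm : 4 * ((1 + C) * Lam) * x ≤ 1) :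
    0 < Den ∧ Num / Den ≤ lam + 2 * (2 * (1 + C) * Lam ^ 2 + Lam * (2 * C + 1)) * x := by
  have hL : 0 ≤ Lam := hl.trans hlL
  have hqQ : q ≤ 1 + C := hq.trans (by nlinarith)
  have hql : q * lam ≤ (1 + C) * Lam := mul_le_mul hqQ hlL hl (by linarith)
  set P := (1 + C) * Lam with hP
  have hP0 : 0 ≤ P := by positivity
  have h1 : B * (1 - 2 * P * x) ≤ (1 + x) * Den := by
    have : 2 * x * (q * (lam * B)) ≤ 2 * x * (P * B) := by
      rw [← mul_assoc q]; gcongr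
    nlinarith
  have h2 : 1 / 2 ≤ 1 - 2 * P * x := by linarith
  have hD : 0 < Den := by
    have : 0 < (1 + x) * Den := lt_of_lt_of_le (by nlinarith) h1
    exact pos_of_mul_pos_right this (by linarith)
  refine ⟨hD, ?_⟩
  set D' := 2 * (2 * (1 + C) * Lam ^ 2 + Lam * (2 * C + 1)) with hD'
  have hDpos : 0 ≤ D' := by positivity
  rw [div_le_iff₀ hD]
  have h3 : q * lam * (1 + x) ≤ (lam + D' * x) * (1 - 2 * P * x) := by
    have a1 : q * lam * (1 + x) ≤ (1 + C * x) * lam * (1 + x) := by gcongr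
    have a2 : (1 + C * x) * lam * (1 + x) ≤ lam + (2 * C + 1) * x * Lam := by
      have : (1 + C * x) * (1 + x) ≤ 1 + (2 * C + 1) * x := by nlinarith [mul_nonneg hC hx.le]
      calc (1 + C * x) * lam * (1 + x) = lam * ((1 + C * x) * (1 + x)) := by ring
        _ ≤ lam * (1 + (2 * C + 1) * x) := by gcongr
        _ = lam + (2 * C + 1) * x * lam := by ring
        _ ≤ _ := by gcongr
    have a3 : lam * (2 * P * x) ≤ Lam * (2 * P * x) := by gcongr
    have a4 : D' * x * (1 / 2) ≤ D' * x * (1 - 2 * P * x) := by gcongr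
    have a5 : D' * x * (1 / 2) = Lam * (2 * P * x) + (2 * C + 1) * x * Lam := by rw [hD', hP]; ring
    nlinarith
  have h4 : (1 + x) * Num ≤ (1 + x) * ((lam + D' * x) * Den) := by
    calc (1 + x) * Num ≤ (1 + x) * (q * (lam * B)) := by gcongr
      _ = q * lam * (1 + x) * B := by ring
      _ ≤ (lam + D' * x) * (1 - 2 * P * x) * B := by gcongr
      _ = (lam + D' * x) * (B * (1 - 2 * P * x)) := by ring
      _ ≤ (lam + D' * x) * ((1 + x) * Den) := by gcongr
      _ = _ := by ring
  exact le_of_mul_le_mul_left h4 (by linarith)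

lemma pow_aux (p : ℕ) (x : ℝ) (hx : 0 ≤ x) (hx1 : x ≤ 1) : (1 + x) ^ p ≤ 1 + 2 ^ p * x := by
  have key : (1 + x) ^ p ≤ 1 + (2 ^ p - 1) * x := by
    induction p with
    | zero => simp
    | succ p ih =>
      have h2 : (0:ℝ) ≤ 2 ^ p - 1 := sub_nonneg.2 (one_le_pow₀ (by norm_num))
      rw [pow_succ, pow_succ]
      have h3 : (1 + x) ^ p * (1 + x) ≤ (1 + (2 ^ p - 1) * x) * (1 + x) := by gcongr
      nlinarith [mul_nonneg h2 (mul_nonneg hx (sub_nonneg.2 hx1))]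
  linarith

lemma sdisc_le (m N K : ℕ) (hK : 0 < K) (hKN : K < N) (hl4 : 4 ≤ Real.log (N / K))
    (hsm : 4 * ((1 + 2 ^ (m+2)) * ((((m:ℝ) + 1) / 2) ^ 2 + 1)) * (1 / (K:ℝ)) ≤ 1) :
    SdiscN (m + 3) N ≤ (((m:ℝ) + 1) / 2) ^ 2 + 10 / Real.log (N / K) ^ 2 + 
      2 * (2 * (1 + 2 ^ (m+2)) * ((((m:ℝ) + 1) / 2) ^ 2 + 1) ^ 2 + ((((m:ℝ) + 1) / 2) ^ 2 + 1) * (2 * 2 ^ (m+2) + 1)) * (1 / (K:ℝ)) := by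
  have hN : (0:ℝ) < N := by exact_mod_cast (by omega : 0 < N)
  have hKr : (1:ℝ) ≤ K := by exact_mod_cast hK
  have ha : (0:ℝ) < K / N := by positivity
  have ha1 : (K:ℝ) / N ≤ 1 := by rw [div_le_one hN]; exact_mod_cast hKN.le
  have hle : -Real.log ((K:ℝ) / N) = Real.log (N / K) := by rw [← Real.log_inv, inv_div]
  set l := Real.log (N / K) with hl
  set α := ((m:ℝ) + 1) / 2 with hα
  obtain ⟨v, hv, hv1, hnum, hden⟩ := interp_main (uu m l) (uu' m l) m N K hK hKN (fun x hx => uu_deriv m l x hx) (uu'_cont m l)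
    (by unfold uu; rw [hle]; simp) (by simp [uu])
  have hA := uu_A m _ ha ha1
  have hB := uu_B m _ ha ha1
  rw [hle] at hA hB
  have hA' : α ^ 2 * (l ^ 5 / 30) + l ^ 3 / 3 = (α ^ 2 + 10 / l ^ 2) * (l ^ 5 / 30) := by
    field_simp; norm_num; ring
  rw [hA, hA'] at hnum hden
  rw [hB] at hden
  have hlam : 10 / l ^ 2 ≤ 1 := by rw [div_le_one (by positivity)]; nlinarith
  obtain ⟨hD, hq⟩ := fin_aux (l ^ 5 / 30) (α ^ 2 + 10 / l ^ 2) (α ^ 2 + 1) (1 / K) ((1 + 1 / (K:ℝ)) ^ (m + 2)) (2 ^ (m+2))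
    _ _ (by positivity) (by positivity) (by linarith) (by positivity) (by rw [div_le_one (by linarith)]; exact hKr)
    (by positivity) (by positivity) (pow_aux _ _ (by positivity) (by rw [div_le_one (by linarith)]; exact hKr)) hnum
    (hden.trans (by rw [show (2:ℝ) / K = 2 * (1 / K) by ring])) hsm
  refine le_trans (csInf_le ?_ ?_) hq
  · refine ⟨0, ?_⟩
    rintro s ⟨w, -, -, -, rfl⟩
    apply div_nonneg
    · apply intervalIntegral.integral_nonneg zero_le_one
      intro x hx
      have := hx.1
      positivity
    · apply intervalIntegral.integral_nonneg zero_le_one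
      intro x hx
      have := hx.1
      positivity
  · refine ⟨v, hv, hv1, ?_, rfl⟩
    by_contra hcon
    push Not at hcon
    apply hD.ne'
    have : ∫ r in (0:ℝ)..1, r ^ m * v r ^ 2 = ∫ r in (0:ℝ)..1, (0:ℝ) := by
      apply intervalIntegral.integral_congr
      intro x hx
      rw [uIcc_of_le zero_le_one] at hx
      simp [hcon x hx]
    rw [this]; simp

lemma K_tendsto : Tendsto (fun N : ℕ => N.sqrt.sqrt) atTop atTop := by
  rw [tendsto_atTop]
  intro b
  filter_upwards [eventually_ge_atTop ((b * b) * (b * b))] with N hN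
  rw [Nat.le_sqrt, Nat.le_sqrt]; exact hN

/-- Upper bound: for `h = 1/N` small,
`S^n_h ≤ (n−2)²/4 + (n+1)²π²/(2|log h| − 6 log|log h|)² + η/(log h)²`. -/
theorem discrete_hardy_nd_upper_bound (n : ℕ) (hn : 3 ≤ n) :
    ∀ η : ℝ, 0 < η → ∃ N₀ : ℕ, ∀ N : ℕ, N₀ ≤ N →
      SdiscN n N ≤ ((n : ℝ) - 2) ^ 2 / 4
        + ((n : ℝ) + 1) ^ 2 * π ^ 2
            / (2 * |Real.log (1 / (N : ℝ))| - 6 * Real.log |Real.log (1 / (N : ℝ))|) ^ 2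
        + η / (Real.log (1 / (N : ℝ))) ^ 2 := by
  intro η hη
  obtain ⟨m, rfl⟩ : ∃ m, n = m + 3 := ⟨n - 3, by omega⟩
  set C' : ℝ := 2 * (2 * (1 + 2 ^ (m+2)) * ((((m:ℝ) + 1) / 2) ^ 2 + 1) ^ 2 + ((((m:ℝ) + 1) / 2) ^ 2 + 1) * (2 * 2 ^ (m+2) + 1)) with hC'
  have hCpos : 0 < C' := by positivity
  have hKR : Tendsto (fun N : ℕ => ((N.sqrt.sqrt : ℕ) : ℝ)) atTop atTop := tendsto_natCast_atTop_atTop.comp K_tendsto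
  have hL : Tendsto (fun N : ℕ => Real.log (N : ℝ)) atTop atTop := Real.tendsto_log_atTop.comp tendsto_natCast_atTop_atTop
  have E1 : ∀ᶠ y : ℝ in atTop, Real.log y ^ 2 ≤ (18 / (32 * C')) * y := by
    have := (isLittleO_pow_log_id_atTop (n := 2)).bound (show 0 < 18 / (32 * C') by positivity)
    filter_upwards [this, eventually_ge_atTop 0] with y hy hy0
    simpa [abs_of_nonneg hy0] using hy
  have E2 : ∀ᶠ N : ℕ in atTop, Real.log (2 * ((N.sqrt.sqrt : ℕ) : ℝ)) ^ 2 ≤ (18 / (32 * C')) * (2 * ((N.sqrt.sqrt : ℕ) : ℝ)) :=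
    (hKR.const_mul_atTop (by norm_num : (0:ℝ) < 2)).eventually E1
  have E3 : ∀ᶠ y : ℝ in atTop, Real.log y ≤ (1 / 6) * y := by
    have := Real.isLittleO_log_id_atTop.bound (show (0:ℝ) < 1 / 6 by positivity)
    filter_upwards [this, eventually_ge_atTop 0] with y hy hy0
    have := (le_abs_self _).trans hy
    simpa [abs_of_nonneg hy0] using this
  have E4 := hL.eventually E3
  rw [← eventually_atTop]
  filter_upwards [E2, E4, hL.eventually_ge_atTop 8, hKR.eventually_ge_atTop (4 * ((1 + 2 ^ (m+2)) * ((((m:ℝ) + 1) / 2) ^ 2 + 1))),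
    K_tendsto.eventually_ge_atTop 1] with N e2 e4 e5 e6 e7
  set K := N.sqrt.sqrt with hK
  set L := Real.log (N:ℝ) with hLd
  have hKr : (1:ℝ) ≤ K := by exact_mod_cast e7
  have hK4 : K ^ 4 ≤ N := by
    have h1 : K * K ≤ N.sqrt := Nat.sqrt_le _
    have h2 : N.sqrt * N.sqrt ≤ N := Nat.sqrt_le _
    calc K ^ 4 = (K * K) * (K * K) := by ring
      _ ≤ N.sqrt * N.sqrt := Nat.mul_le_mul h1 h1
      _ ≤ N := h2
  have hN4 : N ≤ (2 * K) ^ 4 := by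
    have h1 : N.sqrt < (K + 1) * (K + 1) := Nat.lt_succ_sqrt _
    have h2 : N < (N.sqrt + 1) * (N.sqrt + 1) := Nat.lt_succ_sqrt _
    have h3 : N.sqrt + 1 ≤ (2 * K) * (2 * K) := le_trans h1 (Nat.mul_le_mul (by omega) (by omega))
    calc N ≤ (N.sqrt + 1) * (N.sqrt + 1) := h2.le
      _ ≤ ((2 * K) * (2 * K)) * ((2 * K) * (2 * K)) := Nat.mul_le_mul h3 h3
      _ = _ := by ring
  have hN0 : 0 < N := lt_of_lt_of_le (by positivity) hK4
  have hNr : (0:ℝ) < N := by exact_mod_cast hN0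
  have hlogK : 4 * Real.log K ≤ L := by
    have : Real.log ((K:ℝ) ^ 4) ≤ Real.log N := Real.log_le_log (by positivity) (by exact_mod_cast hK4)
    rw [Real.log_pow] at this
    exact_mod_cast this
  have hlog2K : L ≤ 4 * Real.log (2 * K) := by
    have : Real.log N ≤ Real.log ((2 * (K:ℝ)) ^ 4) := Real.log_le_log hNr (by exact_mod_cast hN4)
    rw [Real.log_pow] at this
    exact_mod_cast this
  have hll : Real.log ((N:ℝ) / K) = L - Real.log K := Real.log_div hNr.ne' (by positivity)
  have hl34 : 3 / 4 * L ≤ Real.log ((N:ℝ) / K) := by rw [hll]; linarith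
  have hKN : K < N := by
    by_contra h
    push Not at h
    have : (N:ℝ) / K ≤ 1 := by rw [div_le_one (by linarith)]; exact_mod_cast h
    have := Real.log_nonpos (by positivity) this
    linarith
  have main := sdisc_le m N K e7 hKN (by linarith) (by rw [mul_one_div, div_le_one (by linarith)]; exact e6)
  rw [← hC'] at main
  have hlog : |Real.log (1 / (N:ℝ))| = L := by
    rw [one_div, Real.log_inv, abs_neg, abs_of_nonneg (by linarith)]
  have hlog2 : Real.log (1 / (N:ℝ)) ^ 2 = L ^ 2 := by
    rw [one_div, Real.log_inv, neg_sq]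
  rw [hlog, hlog2]
  refine main.trans ?_
  have i1 : 10 / Real.log ((N:ℝ) / K) ^ 2 ≤ 18 / L ^ 2 := by
    rw [div_le_div_iff₀ (by have : 0 < Real.log ((N:ℝ) / K) := by linarith
                            positivity) (by positivity)]
    nlinarith [mul_self_le_mul_self (by linarith) hl34]
  have i2 : C' * (1 / (K:ℝ)) ≤ 18 / L ^ 2 := by
    rw [mul_one_div, div_le_div_iff₀ (by positivity) (by positivity)]
    have j1 : L ^ 2 ≤ 16 * Real.log (2 * K) ^ 2 := by nlinarith
    calc C' * L ^ 2 ≤ C' * (16 * ((18 / (32 * C')) * (2 * (K:ℝ)))) := by gcongr; linarith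
      _ = 18 * K := by field_simp; norm_num
  have hlL : 0 ≤ Real.log L := Real.log_nonneg (by linarith)
  have i3 : 36 / L ^ 2 ≤ (((m + 3 : ℕ) : ℝ) + 1) ^ 2 * π ^ 2 / (2 * L - 6 * Real.log L) ^ 2 := by
    have hpos : 0 < 2 * L - 6 * Real.log L := by linarith
    have hm : (0:ℝ) ≤ m := by positivity
    calc 36 / L ^ 2 = (4 ^ 2 * 3 ^ 2) / (2 * L) ^ 2 := by field_simp; norm_num
      _ ≤ _ := by
        gcongr
        · push_cast; linarith
        · exact Real.pi_gt_three.le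
        · linarith
  have i4 : 0 ≤ η / L ^ 2 := by positivity
  have i5 : (((m:ℝ) + 1) / 2) ^ 2 = ((((m + 3 : ℕ) : ℝ)) - 2) ^ 2 / 4 := by push_cast; ring
  have i6 : 18 / L ^ 2 + 18 / L ^ 2 = 36 / L ^ 2 := by ring
  linarith
end
end
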